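/- arXiv:2005.00303 — 8 statements merged into one kernel-verified Lean document; each statement's English description precedes it below -/
import Mathlib

section
/- For every N ≥ 2 there is a constant C₀ > 0, depending only on N, with the following property: for every C¹ N-function Φ, every M > 0, and every locally integrable function u : ℝ^N → ℝ with a weak gradient g satisfying ∫_{ℝ^N} Φ(‖g‖) dx ≤ M, ∫_{ℝ^N} Φ(|u|) dx < ∞ and 0 < ∫_{ℝ^N} Φ(|u|/2) dx < ∞, there exists y₀ ∈ ℝ^N such that (2 + M · (∫_{ℝ^N} Φ(|u|/2) dx)^{-1})^N · mes( K(y₀) ∩ {x : u(x) ≠ 0} ) ≥ C₀, where K(z) = ∏_{i=1}^N (z_i − 1/2, z_i + 1/2) is the open unit cube centered at z and mes denotes Lebesgue measure. -/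
open MeasureTheory Filter Topology ENNReal

noncomputable section

/-- An N-function: continuous, convex, even, nonnegative, vanishing only at `0`, with
`Φ(t)/t → 0` as `t → 0` and `Φ(t)/t → ∞` as `t → ∞`. -/
def IsNFunction (Φ : ℝ → ℝ) : Prop :=
  Continuous Φ ∧ ConvexOn ℝ Set.univ Φ ∧ (∀ t, 0 ≤ Φ t) ∧
  (∀ t, Φ t = 0 ↔ t = 0) ∧ (∀ t, Φ (-t) = Φ t) ∧
  Tendsto (fun t => Φ t / t) (𝓝[≠] (0 : ℝ)) (𝓝 0) ∧
  Tendsto (fun t => Φ t / t) atTop atTop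

/-- A locally integrable function `u : ℝ^N → ℝ` has weak gradient `g : ℝ^N → ℝ^N`. -/
def HasWeakGradient {N : ℕ} (u : EuclideanSpace ℝ (Fin N) → ℝ)
    (g : EuclideanSpace ℝ (Fin N) → EuclideanSpace ℝ (Fin N)) : Prop :=
  LocallyIntegrable u volume ∧ LocallyIntegrable g volume ∧
  ∀ φ : EuclideanSpace ℝ (Fin N) → ℝ, ContDiff ℝ (⊤ : ℕ∞) φ → HasCompactSupport φ →
    ∀ i : Fin N,
      (∫ x, u x * fderiv ℝ φ x (EuclideanSpace.single i 1)) =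
        - ∫ x, g x i * φ x

/-- `K(z) = ∏ᵢ (zᵢ - 1/2, zᵢ + 1/2)`, the open unit cube centered at `z`. -/
def unitCube {N : ℕ} (z : EuclideanSpace ℝ (Fin N)) : Set (EuclideanSpace ℝ (Fin N)) :=
  {x | ∀ i, x i ∈ Set.Ioo (z i - 1/2) (z i + 1/2)}

/-- Lebesgue measure on `(0, 1]`, used to average along segments. -/
abbrev segmentMeasure : Measure ℝ := volume.restrict (Set.Ioc 0 1)

instance isProbabilityMeasure_segmentMeasure : IsProbabilityMeasure segmentMeasure := ⟨by simp⟩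

lemma ae_fst_mem_Ioc {E : Type*} [MeasurableSpace E] (κ : Measure E) [SFinite κ] :
    ∀ᵐ p ∂(segmentMeasure.prod κ), p.1 ∈ Set.Ioc (0:ℝ) 1 :=
  Measure.quasiMeasurePreserving_fst.ae (ae_restrict_mem measurableSet_Ioc)

lemma norm_smul_le_of_mem_Ioc {E : Type*} [NormedAddCommGroup E] [NormedSpace ℝ E]
    {t : ℝ} (ht : t ∈ Set.Ioc (0:ℝ) 1) (h : E) : ‖t • h‖ ≤ ‖h‖ := by
  rw [norm_smul, Real.norm_of_nonneg ht.1.le]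
  exact mul_le_of_le_one_left (norm_nonneg _) ht.2

lemma integral_fderiv_segment {E : Type*} [NormedAddCommGroup E] [NormedSpace ℝ E]
    {φ : E → ℝ} (hφ : ContDiff ℝ 1 φ) (x h : E) :
    ∫ t, fderiv ℝ φ (x - t • h) h ∂segmentMeasure = φ x - φ (x - h) := by
  have hd : ∀ t : ℝ, HasDerivAt (fun t : ℝ => - φ (x - t • h)) (fderiv ℝ φ (x - t • h) h) t := by
    intro t
    have h1 : HasDerivAt (fun t : ℝ => x - t • h) (-h) t := by
      simpa using ((hasDerivAt_id t).smul_const h).const_sub x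
    have h2 := ((hφ.differentiable one_ne_zero (x - t • h)).hasFDerivAt.comp_hasDerivAt t h1).neg
    simpa [Function.comp_def, Pi.neg_def] using h2
  have hc : Continuous fun t : ℝ => fderiv ℝ φ (x - t • h) h :=
    ((hφ.continuous_fderiv one_ne_zero).comp (by fun_prop)).clm_apply continuous_const
  rw [← intervalIntegral.integral_of_le zero_le_one,
    intervalIntegral.integral_eq_sub_of_hasDerivAt (fun t _ => hd t) (hc.intervalIntegrable _ _)]
  simp
  ring

section Translation

variable {E : Type*} [NormedAddCommGroup E] [NormedSpace ℝ E] [FiniteDimensional ℝ E]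
  [MeasurableSpace E] [BorelSpace E] {F : Type*} [NormedAddCommGroup F]
  (μ : Measure E) [μ.IsAddHaarMeasure]

lemma measurePreserving_shear (h : E) :
    MeasurePreserving (fun p : ℝ × E => (p.1, p.2 + p.1 • h))
      (segmentMeasure.prod μ) (segmentMeasure.prod μ) := by
  refine (MeasurePreserving.id _).skew_product (g := fun t x => x + t • h) ?_ ?_
  · exact (by fun_prop : Continuous fun p : ℝ × E => p.2 + p.1 • h).measurable
  · exact Eventually.of_forall fun t => map_add_right_eq_self μ (t • h)

variable {μ}

lemma integrable_shear {f : E → F} (hf : Integrable f μ) (h : E) :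
    Integrable (fun p : ℝ × E => f (p.2 + p.1 • h)) (segmentMeasure.prod μ) :=
  (measurePreserving_shear μ h).integrable_comp_of_integrable (hf.comp_snd segmentMeasure)

lemma integrable_shear_restrict_closedBall {f : E → F} (hf : LocallyIntegrable f μ) (h : E)
    (R : ℝ) :
    Integrable (fun p : ℝ × E => f (p.2 + p.1 • h))
      (segmentMeasure.prod (μ.restrict (Metric.closedBall 0 R))) := by
  set B := Metric.closedBall (0 : E) (R + ‖h‖)
  have h1 : Integrable (B.indicator f) μ :=
    (hf.integrableOn_isCompact (isCompact_closedBall _ _)).integrable_indicator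
      Metric.isClosed_closedBall.measurableSet
  have h2 := (integrable_shear h1 h).mono_measure
    (Measure.prod_mono le_rfl (Measure.restrict_le_self (s := Metric.closedBall (0 : E) R)))
  refine h2.congr ?_
  have h3 : ∀ᵐ p ∂(segmentMeasure.prod (μ.restrict (Metric.closedBall (0 : E) R))),
      p.2 ∈ Metric.closedBall (0 : E) R :=
    Measure.quasiMeasurePreserving_snd.ae
      (ae_restrict_mem Metric.isClosed_closedBall.measurableSet)
  filter_upwards [h3, ae_fst_mem_Ioc (μ.restrict (Metric.closedBall (0 : E) R))] with p hp ht
  refine Set.indicator_of_mem ?_ f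
  rw [mem_closedBall_zero_iff] at hp ⊢
  exact (norm_add_le _ _).trans (add_le_add hp (norm_smul_le_of_mem_Ioc ht h))

lemma ae_integrable_segment {f : E → F} (hf : LocallyIntegrable f μ) (h : E) :
    ∀ᵐ x ∂μ, Integrable (fun t : ℝ => f (x + t • h)) segmentMeasure := by
  rw [← Measure.restrict_univ (μ := μ), ← Metric.iUnion_closedBall_nat (0 : E),
    ae_restrict_iUnion_iff]
  exact fun n => (integrable_shear_restrict_closedBall hf h n).prod_left_ae

lemma locallyIntegrable_integral_segment [NormedSpace ℝ F] {f : E → F}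
    (hf : LocallyIntegrable f μ) (h : E) :
    LocallyIntegrable (fun x => ∫ t, f (x + t • h) ∂segmentMeasure) μ := by
  rw [locallyIntegrable_iff]
  intro K hK
  obtain ⟨R, hR⟩ := hK.isBounded.subset_closedBall 0
  exact (integrable_shear_restrict_closedBall hf h R).integral_prod_right.mono_measure
    (Measure.restrict_mono hR le_rfl)

lemma locallyIntegrable_comp_add_right {f : E → F} (hf : LocallyIntegrable f μ) (h : E) :
    LocallyIntegrable (fun x => f (x + h)) μ := by
  rw [locallyIntegrable_iff] at hf ⊢
  intro K hK
  have := (measurePreserving_add_right μ h).integrableOn_comp_preimage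
    (measurableEmbedding_addRight h) (f := f) (s := (fun x => x + h) '' K)
  rw [Set.preimage_image_eq _ (add_left_injective h)] at this
  exact this.2 (hf _ (hK.image (by fun_prop)))

lemma integral_mul_integral_segment {f φ : E → ℝ} (hf : LocallyIntegrable f μ)
    (hφ : Continuous φ) (hφc : HasCompactSupport φ) (h : E) :
    ∫ x, φ x * ∫ t, f (x + t • h) ∂segmentMeasure ∂μ =
      ∫ t, ∫ x, φ x * f (x + t • h) ∂μ ∂segmentMeasure := by
  obtain ⟨R, hR⟩ := hφc.isCompact.isBounded.subset_closedBall 0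
  have hz : ∀ x ∉ Metric.closedBall (0 : E) R, φ x = 0 := fun x hx =>
    image_eq_zero_of_notMem_tsupport fun h => hx (hR h)
  obtain ⟨C, hC⟩ := hφc.exists_bound_of_continuous hφ
  have hint : Integrable (fun p : ℝ × E => φ p.2 * f (p.2 + p.1 • h))
      (segmentMeasure.prod (μ.restrict (Metric.closedBall 0 R))) :=
    (integrable_shear_restrict_closedBall hf h R).bdd_mul
      (by fun_prop : Continuous fun p : ℝ × E => φ p.2).aestronglyMeasurable
      (Eventually.of_forall fun p => hC p.2)
  calc _ = ∫ x in Metric.closedBall 0 R, φ x * ∫ t, f (x + t • h) ∂segmentMeasure ∂μ :=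
        (setIntegral_eq_integral_of_forall_compl_eq_zero fun x hx => by simp [hz x hx]).symm
    _ = ∫ x in Metric.closedBall 0 R, ∫ t, φ x * f (x + t • h) ∂segmentMeasure ∂μ := by
        simp_rw [integral_const_mul]
    _ = ∫ t, ∫ x in Metric.closedBall 0 R, φ x * f (x + t • h) ∂μ ∂segmentMeasure :=
        (integral_integral_swap (f := fun t x => φ x * f (x + t • h)) hint).symm
    _ = _ := by
        congr 1 with t
        exact setIntegral_eq_integral_of_forall_compl_eq_zero fun x hx => by simp [hz x hx]

lemma integral_mul_fderiv_segment {u φ : E → ℝ} (hu : LocallyIntegrable u μ)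
    (hφ : ContDiff ℝ 1 φ) (hφc : HasCompactSupport φ) (h : E) :
    ∫ t, ∫ x, u x * fderiv ℝ φ (x - t • h) h ∂μ ∂segmentMeasure =
      ∫ x, u x * (φ x - φ (x - h)) ∂μ := by
  obtain ⟨R, hR⟩ := hφc.isCompact.isBounded.subset_closedBall 0
  set D : E → ℝ := fun x => fderiv ℝ φ x h
  have hDc : Continuous D := (hφ.continuous_fderiv one_ne_zero).clm_apply continuous_const
  have hDs : HasCompactSupport D := hφc.fderiv_apply (𝕜 := ℝ) h
  obtain ⟨C, hC⟩ := hDs.exists_bound_of_continuous hDc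
  set B := Metric.closedBall (0 : E) (R + ‖h‖)
  have hout : ∀ x ∉ B, ∀ t ∈ Set.Ioc (0:ℝ) 1, x - t • h ∉ tsupport φ := by
    intro x hx t ht hmem
    apply hx
    have := hR hmem
    rw [mem_closedBall_zero_iff] at this ⊢
    calc ‖x‖ = ‖(x - t • h) + t • h‖ := by simp
      _ ≤ _ := (norm_add_le _ _).trans (add_le_add this (norm_smul_le_of_mem_Ioc ht h))
  have hint : Integrable (fun p : ℝ × E => u p.2 * D (p.2 - p.1 • h))
      (segmentMeasure.prod (μ.restrict B)) :=
    (Integrable.comp_snd (hu.integrableOn_isCompact (isCompact_closedBall _ _))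
      segmentMeasure).mul_bdd
      (by fun_prop : Continuous fun p : ℝ × E => D (p.2 - p.1 • h)).aestronglyMeasurable
      (Eventually.of_forall fun p => hC _)
  calc _ = ∫ t, ∫ x in B, u x * D (x - t • h) ∂μ ∂segmentMeasure := by
        refine setIntegral_congr_fun measurableSet_Ioc fun t ht => ?_
        refine (setIntegral_eq_integral_of_forall_compl_eq_zero fun x hx => ?_).symm
        have : fderiv ℝ φ (x - t • h) = 0 := image_eq_zero_of_notMem_tsupport
          fun hm => hout x hx t ht (tsupport_fderiv_subset ℝ hm)
        simp [this]
    _ = ∫ x in B, ∫ t, u x * D (x - t • h) ∂segmentMeasure ∂μ :=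
        integral_integral_swap (f := fun t x => u x * D (x - t • h)) hint
    _ = ∫ x in B, u x * (φ x - φ (x - h)) ∂μ := by
        simp_rw [integral_const_mul, D, integral_fderiv_segment hφ]
    _ = _ := by
        refine setIntegral_eq_integral_of_forall_compl_eq_zero fun x hx => ?_
        have h1 := image_eq_zero_of_notMem_tsupport (hout x hx 1 (by simp))
        have h2 : φ x = 0 := image_eq_zero_of_notMem_tsupport fun hm => hx
          ((hR.trans (Metric.closedBall_subset_closedBall (by simp))) hm)
        rw [one_smul] at h1
        simp [h1, h2]

end Translation

section WeakGradient

variable {N : ℕ} {u : EuclideanSpace ℝ (Fin N) → ℝ}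
  {g : EuclideanSpace ℝ (Fin N) → EuclideanSpace ℝ (Fin N)}

lemma MeasureTheory.LocallyIntegrable.inner_const (hg : LocallyIntegrable g volume)
    (h : EuclideanSpace ℝ (Fin N)) : LocallyIntegrable (fun x => inner ℝ (g x) h) volume := by
  rw [locallyIntegrable_iff] at hg ⊢
  exact fun K hK => Integrable.inner_const (hg K hK) h

lemma HasWeakGradient.integral_mul_fderiv (hug : HasWeakGradient u g)
    {φ : EuclideanSpace ℝ (Fin N) → ℝ} (hφ : ContDiff ℝ (⊤ : ℕ∞) φ) (hφc : HasCompactSupport φ)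
    (h : EuclideanSpace ℝ (Fin N)) :
    ∫ x, u x * fderiv ℝ φ x h = - ∫ x, inner ℝ (g x) h * φ x := by
  obtain ⟨hu, hg, hw⟩ := hug
  have hsum : h = ∑ i, h i • EuclideanSpace.single i (1:ℝ) := by
    ext j
    simp [Finset.sum_apply, Pi.single_apply]
  have h1 : ∀ x, u x * fderiv ℝ φ x h =
      ∑ i, h i * (u x * fderiv ℝ φ x (EuclideanSpace.single i 1)) := by
    intro x
    conv_lhs => rw [hsum]
    simp only [map_sum, map_smul, smul_eq_mul, Finset.mul_sum]
    exact Finset.sum_congr rfl fun i _ => by ring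
  have h2 : ∀ x, inner ℝ (g x) h * φ x = ∑ i, h i * (g x i * φ x) := by
    intro x
    simp only [PiLp.inner_apply, Finset.sum_mul]
    exact Finset.sum_congr rfl fun i _ => by simp [mul_assoc]
  simp_rw [h1, h2]
  rw [integral_finsetSum, integral_finsetSum, ← Finset.sum_neg_distrib]
  · refine Finset.sum_congr rfl fun i _ => ?_
    rw [integral_const_mul, integral_const_mul, hw φ hφ hφc i, mul_neg]
  · intro i _
    have hgi : LocallyIntegrable (fun x => g x i) volume := by
      simpa [EuclideanSpace.inner_single_right] using hg.inner_const (EuclideanSpace.single i 1)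
    exact (hgi.integrable_smul_right_of_hasCompactSupport hφ.continuous hφc).const_mul _
  · intro i _
    exact (hu.integrable_smul_right_of_hasCompactSupport
      ((hφ.continuous_fderiv (by simp)).clm_apply continuous_const)
      (hφc.fderiv_apply (𝕜 := ℝ) (EuclideanSpace.single i 1))).const_mul _

lemma HasWeakGradient.sub_ae_eq_integral_segment (hug : HasWeakGradient u g)
    (h : EuclideanSpace ℝ (Fin N)) :
    ∀ᵐ x, u (x + h) - u x = ∫ t, inner ℝ (g (x + t • h)) h ∂segmentMeasure := by
  have hu := hug.1
  have hG := hug.2.1.inner_const h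
  have huh := locallyIntegrable_comp_add_right hu h
  refine ae_eq_of_integral_contDiff_smul_eq (huh.sub hu)
    (locallyIntegrable_integral_segment hG h) fun φ hφ hφc => ?_
  simp only [smul_eq_mul]
  rw [integral_mul_integral_segment hG hφ.continuous hφc h]
  have hslice : ∀ t : ℝ, ∫ x, φ x * inner ℝ (g (x + t • h)) h =
      - ∫ x, u x * fderiv ℝ φ (x - t • h) h := by
    intro t
    have hφt : ContDiff ℝ (⊤ : ℕ∞) fun x => φ (x - t • h) := hφ.comp (by fun_prop)
    have hφtc : HasCompactSupport fun x => φ (x - t • h) :=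
      hφc.comp_homeomorph (Homeomorph.subRight (t • h))
    have := hug.integral_mul_fderiv hφt hφtc h
    simp_rw [fderiv_comp_sub] at this
    rw [this, neg_neg,
      ← integral_add_right_eq_self (fun x => inner ℝ (g x) h * φ (x - t • h)) (t • h)]
    simp [mul_comm]
  simp_rw [hslice]
  rw [integral_neg, integral_mul_fderiv_segment hu (hφ.of_le (by simp)) hφc h]
  have e1 : Integrable fun x => φ x * u (x + h) :=
    huh.integrable_smul_left_of_hasCompactSupport hφ.continuous hφc
  have e2 : Integrable fun x => φ x * u x :=
    hu.integrable_smul_left_of_hasCompactSupport hφ.continuous hφc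
  have e3 : Integrable fun x => u x * φ (x - h) := by
    simpa [mul_comm] using e1.comp_sub_right h
  have e4 : ∫ x, u x * φ (x - h) = ∫ x, φ x * u (x + h) := by
    rw [← integral_add_right_eq_self (fun x => u x * φ (x - h)) h]
    simp [mul_comm]
  simp_rw [mul_sub]
  rw [integral_sub e1 e2, integral_sub (by simpa [mul_comm] using e2) e3, e4]
  simp [mul_comm]

variable {Φ : ℝ → ℝ}

lemma IsNFunction.map_zero (hΦ : IsNFunction Φ) : Φ 0 = 0 := (hΦ.2.2.2.1 0).2 rfl

lemma IsNFunction.map_mul_le (hΦ : IsNFunction Φ) {c : ℝ} (h0 : 0 ≤ c) (h1 : c ≤ 1) (t : ℝ) :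
    Φ (c * t) ≤ c * Φ t := by
  have := hΦ.2.1.2 (Set.mem_univ t) (Set.mem_univ 0) h0 (sub_nonneg.2 h1) (by ring)
  simpa [hΦ.map_zero] using this

lemma IsNFunction.monotoneOn (hΦ : IsNFunction Φ) : MonotoneOn Φ (Set.Ici 0) := by
  intro s hs t ht hst
  rcases (Set.mem_Ici.1 ht).eq_or_lt with rfl | ht'
  · rw [le_antisymm hst hs]
  · have hle : s / t ≤ 1 := (div_le_one ht').2 hst
    calc Φ s = Φ (s / t * t) := by rw [div_mul_cancel₀ _ ht'.ne']
      _ ≤ s / t * Φ t := hΦ.map_mul_le (div_nonneg hs ht) hle t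
      _ ≤ Φ t := mul_le_of_le_one_left (hΦ.2.2.1 t) hle

lemma HasWeakGradient.lintegral_translate_sub_le (hug : HasWeakGradient u g)
    (hΦ : IsNFunction Φ) (hg : Integrable fun x => Φ ‖g x‖)
    {h : EuclideanSpace ℝ (Fin N)} (hh : ‖h‖ ≤ 1) :
    ∫⁻ x, ENNReal.ofReal (Φ |u (x + h) - u x|) ≤ ENNReal.ofReal (‖h‖ * ∫ x, Φ ‖g x‖) := by
  have hs := integrable_shear hg h
  have hint : ∫ x, ∫ t, Φ ‖g (x + t • h)‖ ∂segmentMeasure = ∫ x, Φ ‖g x‖ := by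
    rw [← integral_integral_swap (f := fun t x => Φ ‖g (x + t • h)‖) hs]
    simp_rw [integral_add_right_eq_self fun x => Φ ‖g x‖]
    simp
  rw [← hint, ← integral_const_mul, ofReal_integral_eq_lintegral_ofReal
    (hs.integral_prod_right.const_mul _) (Eventually.of_forall fun x =>
      mul_nonneg (norm_nonneg _) (integral_nonneg fun t => hΦ.2.2.1 _))]
  refine lintegral_mono_ae ?_
  filter_upwards [hug.sub_ae_eq_integral_segment h, ae_integrable_segment hug.2.1 h,
    hs.prod_left_ae] with x hx hgx hΦx
  refine ENNReal.ofReal_le_ofReal ?_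
  have habs : |u (x + h) - u x| ≤ ‖h‖ * ∫ t, ‖g (x + t • h)‖ ∂segmentMeasure := by
    rw [hx, ← integral_const_mul, ← Real.norm_eq_abs]
    refine norm_integral_le_of_norm_le (hgx.norm.const_mul _) (Eventually.of_forall fun t => ?_)
    rw [mul_comm]
    exact norm_inner_le_norm _ _
  calc Φ |u (x + h) - u x| ≤ Φ (‖h‖ * ∫ t, ‖g (x + t • h)‖ ∂segmentMeasure) :=
        hΦ.monotoneOn (Set.mem_Ici.2 (abs_nonneg _))
          (Set.mem_Ici.2 ((abs_nonneg _).trans habs)) habs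
    _ ≤ ‖h‖ * Φ (∫ t, ‖g (x + t • h)‖ ∂segmentMeasure) :=
        hΦ.map_mul_le (norm_nonneg _) hh _
    _ ≤ ‖h‖ * ∫ t, Φ ‖g (x + t • h)‖ ∂segmentMeasure :=
        mul_le_mul_of_nonneg_left (hΦ.2.1.map_integral_le hΦ.1.continuousOn isClosed_univ
          (Eventually.of_forall fun _ => Set.mem_univ _) hgx.norm hΦx) (norm_nonneg _)

/-- If every ball of radius `r` meets the zero set of `v` in measure at least `m`, then translation
differences over the ball of radius `r` control `∫ Φ |v|`. -/
lemma measure_mul_lintegral_le_of_translate_sub_le {v : EuclideanSpace ℝ (Fin N) → ℝ}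
    (hv : Measurable v) (hΦ : Measurable Φ) {r : ℝ} {m A : ℝ≥0∞}
    (hA : ∀ h ∈ Metric.ball (0 : EuclideanSpace ℝ (Fin N)) r,
      ∫⁻ x, ENNReal.ofReal (Φ |v (x + h) - v x|) ≤ A)
    (hm : ∀ x, m ≤ volume (Metric.ball x r ∩ {y | v y = 0})) :
    m * ∫⁻ x, ENNReal.ofReal (Φ |v x|) ≤
      A * volume (Metric.ball (0 : EuclideanSpace ℝ (Fin N)) r) := by
  have hmeas : Measurable (Function.uncurry fun x h : EuclideanSpace ℝ (Fin N) =>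
      ENNReal.ofReal (Φ |v (x + h) - v x|)) := by
    have : Measurable fun p : EuclideanSpace ℝ (Fin N) × EuclideanSpace ℝ (Fin N) =>
        |v (p.1 + p.2) - v p.1| :=
      continuous_abs.measurable.comp
        ((hv.comp (measurable_fst.add measurable_snd)).sub (hv.comp measurable_fst))
    exact (hΦ.comp this).ennreal_ofReal
  have hmeas' : Measurable fun x => ENNReal.ofReal (Φ |v x|) :=
    (hΦ.comp (continuous_abs.measurable.comp hv)).ennreal_ofReal
  rw [← lintegral_const_mul _ hmeas']
  calc ∫⁻ x, m * ENNReal.ofReal (Φ |v x|)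
      ≤ ∫⁻ x, ∫⁻ h in Metric.ball 0 r, ENNReal.ofReal (Φ |v (x + h) - v x|) := by
        refine lintegral_mono fun x => ?_
        set Z : Set (EuclideanSpace ℝ (Fin N)) := {h | v (x + h) = 0}
        have hZ : MeasurableSet Z :=
          (hv.comp (measurable_const_add x)) (measurableSet_singleton 0)
        have hvol : volume (Metric.ball x r ∩ {y | v y = 0}) = volume (Metric.ball 0 r ∩ Z) := by
          rw [← measure_preimage_add volume x]
          congr 1
          ext h
          simp [Z]
        calc m * ENNReal.ofReal (Φ |v x|)
            ≤ ENNReal.ofReal (Φ |v x|) * volume (Metric.ball 0 r ∩ Z) := by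
              rw [mul_comm, ← hvol]
              gcongr
              exact hm x
          _ = ∫⁻ h in Metric.ball 0 r ∩ Z, ENNReal.ofReal (Φ |v x|) :=
              (setLIntegral_const _ _).symm
          _ = ∫⁻ h in Metric.ball 0 r ∩ Z, ENNReal.ofReal (Φ |v (x + h) - v x|) := by
              refine setLIntegral_congr_fun (Metric.isOpen_ball.measurableSet.inter hZ)
                fun h hh => ?_
              have : v (x + h) = 0 := hh.2
              simp [this]
          _ ≤ _ := lintegral_mono_set Set.inter_subset_left
    _ = ∫⁻ h in Metric.ball 0 r, ∫⁻ x, ENNReal.ofReal (Φ |v (x + h) - v x|) :=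
        lintegral_lintegral_swap hmeas.aemeasurable
    _ ≤ ∫⁻ h in Metric.ball (0 : EuclideanSpace ℝ (Fin N)) r, A :=
        setLIntegral_mono measurable_const hA
    _ = _ := setLIntegral_const _ _

lemma ball_subset_unitCube (x : EuclideanSpace ℝ (Fin N)) {r : ℝ} (hr : r ≤ 1 / 2) :
    Metric.ball x r ⊆ unitCube x := by
  intro y hy i
  rw [mem_ball_iff_norm] at hy
  have := ((PiLp.norm_apply_le (y - x) i).trans_lt hy).trans_le hr
  rw [PiLp.sub_apply, Real.norm_eq_abs, abs_lt] at this
  constructor <;> linarith [this.1, this.2]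

lemma volume_unitCube_ne_top (x : EuclideanSpace ℝ (Fin N)) : volume (unitCube x) ≠ ∞ := by
  refine ne_top_of_le_ne_top
    (measure_closedBall_lt_top (x := x) (r := √(N : ℝ))).ne (measure_mono fun y hy => ?_)
  rw [mem_closedBall_iff_norm, EuclideanSpace.norm_eq]
  refine Real.sqrt_le_sqrt ?_
  calc ∑ i, ‖(y - x) i‖ ^ 2 ≤ ∑ _i : Fin N, (1 : ℝ) := by
        refine Finset.sum_le_sum fun i _ => ?_
        have := hy i
        rw [Set.mem_Ioo] at this
        rw [PiLp.sub_apply, Real.norm_eq_abs, sq_abs]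
        nlinarith [this.1, this.2]
    _ = N := by simp

end WeakGradient

/-- Lemma 3.1: there is `C₀ > 0`, depending only on `N`, such that for every C¹
N-function `Φ` and every `u ∈ W^{1,Φ}(ℝ^N)` with `∫ Φ(|∇u|) ≤ M` and
`0 < ∫ Φ(|u|/2) < ∞`, there is `y₀ ∈ ℝ^N` with
`(2 + M (∫ Φ(|u|/2))⁻¹)^N · mes(K(y₀) ∩ supp u) ≥ C₀`. -/
theorem cube_lemma (N : ℕ) (hN : 2 ≤ N) :
    ∃ C₀ : ℝ, 0 < C₀ ∧
      ∀ (Φ : ℝ → ℝ), IsNFunction Φ → ContDiff ℝ 1 Φ →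
      ∀ M : ℝ, 0 < M →
      ∀ (u : EuclideanSpace ℝ (Fin N) → ℝ)
        (g : EuclideanSpace ℝ (Fin N) → EuclideanSpace ℝ (Fin N)),
        HasWeakGradient u g →
        Integrable (fun x => Φ ‖g x‖) → (∫ x, Φ ‖g x‖) ≤ M →
        Integrable (fun x => Φ |u x|) →
        Integrable (fun x => Φ (|u x| / 2)) → 0 < (∫ x, Φ (|u x| / 2)) →
        ∃ y₀ : EuclideanSpace ℝ (Fin N),
          C₀ ≤ (2 + M * (∫ x, Φ (|u x| / 2))⁻¹) ^ N *
            (volume (unitCube y₀ ∩ {x | u x ≠ 0})).toReal := by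
  set ω := (volume (Metric.ball (0 : EuclideanSpace ℝ (Fin N)) 1)).toReal with hω
  have hω0 : 0 < ω := ENNReal.toReal_pos (Metric.measure_ball_pos _ _ one_pos).ne'
    measure_ball_lt_top.ne
  refine ⟨ω / 2 * (1 / 2) ^ N, by positivity, ?_⟩
  intro Φ hΦ _ M hM u g hug hgΦ hgM huΦ huΦ2 hI
  set I := ∫ x, Φ (|u x| / 2)
  by_contra! hcon
  set L := 2 + M * I⁻¹ with hL
  have hMI : 0 < M * I⁻¹ := by positivity
  have hL0 : 0 < L := by positivity
  set r := 1 / (2 * L) with hr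
  have hr0 : 0 < r := by positivity
  have hr2 : r ≤ 1 / 2 := by
    rw [hr, div_le_div_iff₀ (by positivity) two_pos]
    linarith
  set V := volume (Metric.ball (0 : EuclideanSpace ℝ (Fin N)) r) with hV
  have hVtop : V ≠ ∞ := measure_ball_lt_top.ne
  have hVreal : V.toReal = r ^ N * ω := by
    rw [hV, Measure.addHaar_ball_of_pos volume _ hr0, ENNReal.toReal_mul,
      ENNReal.toReal_ofReal (by positivity), finrank_euclideanSpace_fin]
  have hV0 : 0 < V.toReal := by rw [hVreal]; positivity
  obtain ⟨v, hv, huv⟩ := hug.1.aestronglyMeasurable.aemeasurable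
  have hne : ∀ y, volume (Metric.ball y r ∩ {x | v x ≠ 0}) ≤ V / 2 := by
    intro y
    have hae : volume (Metric.ball y r ∩ {x | v x ≠ 0}) =
        volume (Metric.ball y r ∩ {x | u x ≠ 0}) := by
      refine measure_congr ?_
      filter_upwards [huv] with x hx
      exact propext (and_congr_right fun _ => not_congr (by rw [hx]))
    have hle : volume (Metric.ball y r ∩ {x | u x ≠ 0}) ≤
        volume (unitCube y ∩ {x | u x ≠ 0}) :=
      measure_mono (Set.inter_subset_inter_left _ (ball_subset_unitCube y hr2))
    have htop : volume (unitCube y ∩ {x | u x ≠ 0}) ≠ ∞ :=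
      ne_top_of_le_ne_top (volume_unitCube_ne_top y) (measure_mono Set.inter_subset_left)
    rw [hae]
    refine hle.trans ?_
    rw [← ENNReal.toReal_le_toReal htop (ENNReal.div_ne_top hVtop two_ne_zero),
      ENNReal.toReal_div, hVreal, ENNReal.toReal_ofNat]
    have hrL : L ^ N * (r ^ N * ω / 2) = ω / 2 * (1 / 2) ^ N := by
      have : L * r = 1 / 2 := by rw [hr]; field_simp
      rw [← this, mul_pow]
      ring
    exact le_of_mul_le_mul_left ((hcon y).le.trans hrL.ge) (by positivity)
  have hzero : ∀ y, V / 2 ≤ volume (Metric.ball y r ∩ {x | v x = 0}) := by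
    intro y
    have hsplit : V = volume (Metric.ball y r ∩ {x | v x = 0}) +
        volume (Metric.ball y r ∩ {x | v x ≠ 0}) := by
      rw [hV, ← Measure.addHaar_ball_center volume y,
        ← measure_inter_add_sdiff (Metric.ball y r) (hv (measurableSet_singleton 0))]
      rfl
    have h1 : V / 2 + V / 2 ≤ volume (Metric.ball y r ∩ {x | v x = 0}) + V / 2 := by
      rw [ENNReal.add_halves]
      exact hsplit.le.trans (add_le_add_right (hne y) _)
    exact (ENNReal.add_le_add_iff_right (ENNReal.div_ne_top hVtop two_ne_zero)).1 h1
  have hA : ∀ h ∈ Metric.ball (0 : EuclideanSpace ℝ (Fin N)) r,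
      ∫⁻ x, ENNReal.ofReal (Φ |v (x + h) - v x|) ≤ ENNReal.ofReal (r * M) := by
    intro h hh
    rw [mem_ball_zero_iff] at hh
    calc _ = ∫⁻ x, ENNReal.ofReal (Φ |u (x + h) - u x|) := by
          refine lintegral_congr_ae ?_
          filter_upwards [huv,
            (measurePreserving_add_right volume h).quasiMeasurePreserving.ae huv] with x h1 h2
          rw [h1, h2]
      _ ≤ _ := hug.lintegral_translate_sub_le hΦ hgΦ (by linarith)
      _ ≤ _ := ENNReal.ofReal_le_ofReal
          (mul_le_mul hh.le hgM (integral_nonneg fun _ => hΦ.2.2.1 _) hr0.le)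
  have hmain := measure_mul_lintegral_le_of_translate_sub_le hv hΦ.1.measurable hA hzero
  have hJ : ∫⁻ x, ENNReal.ofReal (Φ |v x|) = ENNReal.ofReal (∫ x, Φ |u x|) := by
    rw [ofReal_integral_eq_lintegral_ofReal huΦ (Eventually.of_forall fun _ => hΦ.2.2.1 _)]
    refine lintegral_congr_ae ?_
    filter_upwards [huv] with x hx
    rw [hx]
  have hIJ : I ≤ ∫ x, Φ |u x| := integral_mono huΦ2 huΦ fun x =>
    hΦ.monotoneOn (Set.mem_Ici.2 (by positivity)) (Set.mem_Ici.2 (abs_nonneg _))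
      (half_le_self (abs_nonneg _))
  rw [hJ, ← hV] at hmain
  have hreal := ENNReal.toReal_mono (ENNReal.mul_ne_top ENNReal.ofReal_ne_top hVtop) hmain
  rw [ENNReal.toReal_mul, ENNReal.toReal_mul, ENNReal.toReal_div, ENNReal.toReal_ofNat,
    ENNReal.toReal_ofReal (hI.le.trans hIJ), ENNReal.toReal_ofReal (by positivity)] at hreal
  have h2 : (∫ x, Φ |u x|) ≤ 2 * (r * M) := by
    refine le_of_mul_le_mul_left ?_ hV0
    linarith
  have h3 : I * L ≤ M := by
    calc I * L ≤ 2 * (r * M) * L := mul_le_mul_of_nonneg_right (hIJ.trans h2) hL0.le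
      _ = M := by rw [hr]; field_simp
  have h4 : I * L = 2 * I + M := by rw [hL]; field_simp
  linarith
end
end

section
/- Let Φ : ℝ → [0,∞) be a C¹ N-function and let u : ℝ^N → ℝ be a differentiable function. Then for every measurable set K ⊆ ℝ^N, ∫_K ‖∇(x ↦ Φ(u(x)/2))‖ dx ≤ (1/2) ∫_K Φ(‖∇u(x)‖) dx + (1/2) ∫_K Φ(|u(x)|) dx, where the integrals are allowed to take the value +∞. -/
open MeasureTheory Filter Topology ENNReal

noncomputable section

/-- A convex differentiable function on the line lies above its tangent lines. -/
theorem ConvexOn.deriv_mul_sub_le {f : ℝ → ℝ} (hf : ConvexOn ℝ Set.univ f) {a : ℝ}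
    (hd : DifferentiableAt ℝ f a) (y : ℝ) : deriv f a * (y - a) ≤ f y - f a := by
  rcases lt_trichotomy a y with h | rfl | h
  · have := hf.deriv_le_slope (Set.mem_univ a) (Set.mem_univ y) h hd
    rwa [slope_def_field, le_div_iff₀ (sub_pos.2 h)] at this
  · simp
  · have := hf.slope_le_deriv (Set.mem_univ y) (Set.mem_univ a) h hd
    rw [slope_def_field, div_le_iff₀ (sub_pos.2 h)] at this
    linarith

/-- A Young-type inequality for the derivative of an even nonnegative convex function. -/
theorem ConvexOn.abs_deriv_mul_le {f : ℝ → ℝ} (hf : ConvexOn ℝ Set.univ f)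
    (hnonneg : ∀ t, 0 ≤ f t) (heven : ∀ t, f (-t) = f t) {a : ℝ}
    (hd : DifferentiableAt ℝ f a) {s : ℝ} (hs : 0 ≤ s) :
    |deriv f a| * s ≤ f s + f (2 * a) := by
  have h₁ := hf.deriv_mul_sub_le hd s
  have h₂ := hf.deriv_mul_sub_le hd (-s)
  have h₃ := hf.deriv_mul_sub_le hd (2 * a)
  have h₄ := hnonneg a
  rw [heven] at h₂
  rw [← abs_of_nonneg hs, ← abs_mul, abs_of_nonneg hs, abs_le]
  constructor <;> linarith

/-- Estimate (0E2): for a C¹ N-function `Φ` and a differentiable `u`,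
`∫_K ‖∇(Φ(u/2))‖ ≤ (1/2)∫_K Φ(‖∇u‖) + (1/2)∫_K Φ(|u|)`, the integrals being allowed to
take the value `+∞`. -/
theorem gradient_composition_estimate (N : ℕ) (Φ : ℝ → ℝ)
    (hΦ : IsNFunction Φ) (hΦC1 : ContDiff ℝ 1 Φ)
    (u : EuclideanSpace ℝ (Fin N) → ℝ) (hu : Differentiable ℝ u)
    (K : Set (EuclideanSpace ℝ (Fin N))) (hK : MeasurableSet K) :
    (∫⁻ x in K, ENNReal.ofReal ‖fderiv ℝ (fun y => Φ (u y / 2)) x‖) ≤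
      (1 / 2 : ℝ≥0∞) * (∫⁻ x in K, ENNReal.ofReal (Φ ‖fderiv ℝ u x‖)) +
      (1 / 2 : ℝ≥0∞) * ∫⁻ x in K, ENNReal.ofReal (Φ |u x|) := by
  obtain ⟨hcont, hconv, hnonneg, -, heven, -⟩ := hΦ
  have hd : Differentiable ℝ Φ := hΦC1.differentiable one_ne_zero
  have habs (t : ℝ) : Φ |t| = Φ t := by
    rcases abs_choice t with h | h <;> simp [h, heven]
  have hpt (x : EuclideanSpace ℝ (Fin N)) :
      ‖fderiv ℝ (fun y => Φ (u y / 2)) x‖ ≤ 1 / 2 * (Φ ‖fderiv ℝ u x‖ + Φ |u x|) := by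
    have hchain : HasFDerivAt (fun y => Φ (u y / 2))
        (deriv Φ (u x / 2) • ((2 : ℝ)⁻¹ • fderiv ℝ u x)) x := by
      refine (hd (u x / 2)).hasDerivAt.comp_hasFDerivAt
        (f := fun y => u y / 2) x ?_
      simpa [div_eq_inv_mul] using (hu x).hasFDerivAt.const_mul (2 : ℝ)⁻¹
    have hyoung := hconv.abs_deriv_mul_le hnonneg heven (hd (u x / 2))
      (norm_nonneg (fderiv ℝ u x))
    rw [mul_div_cancel₀ (u x) two_ne_zero] at hyoung
    rw [hchain.fderiv, norm_smul, norm_smul, habs, Real.norm_eq_abs, norm_inv, Real.norm_two]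
    linarith
  have hmeas : Measurable fun x => ENNReal.ofReal (Φ |u x|) :=
    (hcont.comp hu.continuous.abs).measurable.ennreal_ofReal
  rw [← mul_add, ← lintegral_add_right _ hmeas, ← lintegral_const_mul' _ _ (by simp)]
  refine lintegral_mono fun x => (ENNReal.ofReal_le_ofReal (hpt x)).trans_eq ?_
  rw [ENNReal.ofReal_mul (by norm_num), ENNReal.ofReal_add (hnonneg _) (hnonneg _)]
  simp [ENNReal.ofReal_inv_of_pos]
end
end

section
/- Let N ≥ 2 and let φ : (0,∞) → (0,∞) be a continuous function such that t ↦ tφ(t) is strictly increasing on (0,∞) with tφ(t) → 0 as t → 0⁺ and tφ(t) → ∞ as t → ∞; set Φ(t) = ∫_0^{|t|} s φ(s) ds and assume there are l, m ∈ [1, N) with l ≤ m and l ≤ t²φ(t)/Φ(t) ≤ m for all t > 0. Assume ∫_1^{∞} Φ^{-1}(s) s^{-(N+1)/N} ds = +∞, let G(t) = ∫_0^t Φ^{-1}(s) s^{-(N+1)/N} ds for t ≥ 0 (where Φ^{-1} is the inverse of the restriction of Φ to [0,∞)), and let Φ_* : [0,∞) → [0,∞) be the increasing bijection inverse to G. Set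 l* = lN/(N−l) and m* = mN/(N−m). Then for all ρ ≥ 0 and t ≥ 0, min(ρ^{l*}, ρ^{m*}) · Φ_*(t) ≤ Φ_*(ρ t) ≤ max(ρ^{l*}, ρ^{m*}) · Φ_*(t). -/
open MeasureTheory Filter Topology ENNReal

noncomputable section

theorem monotoneOn_mul_rpow_neg {F f : ℝ → ℝ} {p : ℝ}
    (hF : ∀ t, 0 < t → HasDerivAt F (f t) t) (h : ∀ t, 0 < t → p * F t ≤ t * f t) :
    MonotoneOn (fun t => F t * t ^ (-p)) (Set.Ioi 0) := by
  have hd : ∀ t, 0 < t → HasDerivAt (fun t => F t * t ^ (-p))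
      (f t * t ^ (-p) + F t * (-p * t ^ (-p - 1))) t := fun t ht =>
    (hF t ht).mul (Real.hasDerivAt_rpow_const (Or.inl ht.ne'))
  refine monotoneOn_of_deriv_nonneg (convex_Ioi 0)
    (fun t ht => (hd t ht).continuousAt.continuousWithinAt)
    (fun t ht => (hd t (by simpa using ht)).differentiableAt.differentiableWithinAt) ?_
  intro t ht
  have ht : 0 < t := by simpa using ht
  have key : f t * t ^ (-p) + F t * (-p * t ^ (-p - 1)) =
      t ^ (-p - 1) * (t * f t - p * F t) := by
    have : t ^ (-p) = t ^ (-p - 1) * t := by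
      rw [Real.rpow_sub_one ht.ne', div_mul_cancel₀ _ ht.ne']
    rw [this]
    ring
  rw [(hd t ht).deriv, key]
  exact mul_nonneg (Real.rpow_nonneg ht.le _) (sub_nonneg.2 (h t ht))

theorem rpow_mul_le_of_mul_le_mul_deriv {F f : ℝ → ℝ} {p : ℝ}
    (hF : ∀ t, 0 < t → HasDerivAt F (f t) t) (h : ∀ t, 0 < t → p * F t ≤ t * f t)
    {r t : ℝ} (hr : 1 ≤ r) (ht : 0 < t) : r ^ p * F t ≤ F (r * t) := by
  have hr0 : 0 < r := one_pos.trans_le hr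
  have hrt : 0 < r * t := mul_pos hr0 ht
  have hm := monotoneOn_mul_rpow_neg hF h (Set.mem_Ioi.2 ht) (Set.mem_Ioi.2 hrt)
    (le_mul_of_one_le_left ht.le hr)
  simp only [Real.rpow_neg ht.le, Real.rpow_neg hrt.le] at hm
  rw [← div_eq_mul_inv, ← div_eq_mul_inv,
    div_le_div_iff₀ (Real.rpow_pos_of_pos ht _) (Real.rpow_pos_of_pos hrt _),
    Real.mul_rpow hr0.le ht.le] at hm
  refine le_of_mul_le_mul_right ?_ (Real.rpow_pos_of_pos ht p)
  linarith

theorem mul_le_rpow_mul_of_mul_deriv_le {F f : ℝ → ℝ} {p : ℝ}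
    (hF : ∀ t, 0 < t → HasDerivAt F (f t) t) (h : ∀ t, 0 < t → t * f t ≤ p * F t)
    {r t : ℝ} (hr : 1 ≤ r) (ht : 0 < t) : F (r * t) ≤ r ^ p * F t := by
  have := rpow_mul_le_of_mul_le_mul_deriv (F := fun t => -F t) (f := fun t => -f t) (p := p)
    (fun t ht => (hF t ht).neg) (fun t ht => by linarith [h t ht]) hr ht
  linarith

theorem monotoneOn_of_rightInvOn {A B : ℝ → ℝ} (hA : MonotoneOn A (Set.Ici 0))
    (hB : Set.MapsTo B (Set.Ici 0) (Set.Ici 0)) (hAB : Set.RightInvOn B A (Set.Ici 0)) :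
    MonotoneOn B (Set.Ici 0) := by
  intro x hx y hy hxy
  by_contra! hlt
  have := hA (hB hy) (hB hx) hlt.le
  rw [hAB hx, hAB hy] at this
  rw [le_antisymm hxy this] at hlt
  exact lt_irrefl _ hlt

theorem inverse_mul_le_rpow_mul {A B : ℝ → ℝ} {p : ℝ} (hp : 0 < p)
    (hBm : MonotoneOn B (Set.Ici 0)) (hA : Set.MapsTo A (Set.Ici 0) (Set.Ici 0))
    (hB : Set.MapsTo B (Set.Ici 0) (Set.Ici 0)) (hinv : Set.InvOn B A (Set.Ici 0) (Set.Ici 0))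
    (h : ∀ r t, 1 ≤ r → 0 ≤ t → r ^ p * A t ≤ A (r * t))
    {r t : ℝ} (hr : 1 ≤ r) (ht : 0 ≤ t) : B (r * t) ≤ r ^ p⁻¹ * B t := by
  have hr0 : 0 ≤ r := zero_le_one.trans hr
  have hBt : 0 ≤ B t := hB ht
  have hz : 0 ≤ r ^ p⁻¹ * B t := mul_nonneg (Real.rpow_nonneg hr0 _) hBt
  have h1 := h (r ^ p⁻¹) (B t) (Real.one_le_rpow hr (inv_pos.2 hp).le) hBt
  rw [Real.rpow_inv_rpow hr0 hp.ne', hinv.2 ht] at h1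
  have h2 := hBm (mul_nonneg hr0 ht : (0 : ℝ) ≤ r * t) (hA hz) h1
  rwa [hinv.1 hz] at h2

theorem rpow_mul_le_inverse_mul {A B : ℝ → ℝ} {p : ℝ} (hp : 0 < p)
    (hBm : MonotoneOn B (Set.Ici 0)) (hA : Set.MapsTo A (Set.Ici 0) (Set.Ici 0))
    (hB : Set.MapsTo B (Set.Ici 0) (Set.Ici 0)) (hinv : Set.InvOn B A (Set.Ici 0) (Set.Ici 0))
    (h : ∀ r t, 1 ≤ r → 0 ≤ t → A (r * t) ≤ r ^ p * A t)
    {r t : ℝ} (hr : 1 ≤ r) (ht : 0 ≤ t) : r ^ p⁻¹ * B t ≤ B (r * t) := by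
  have hr0 : 0 ≤ r := zero_le_one.trans hr
  have hBt : 0 ≤ B t := hB ht
  have hz : 0 ≤ r ^ p⁻¹ * B t := mul_nonneg (Real.rpow_nonneg hr0 _) hBt
  have h1 := h (r ^ p⁻¹) (B t) (Real.one_le_rpow hr (inv_pos.2 hp).le) hBt
  rw [Real.rpow_inv_rpow hr0 hp.ne', hinv.2 ht] at h1
  have h2 := hBm (hA hz) (mul_nonneg hr0 ht : (0 : ℝ) ≤ r * t) h1
  rwa [hinv.1 hz] at h2

theorem integral_div_rpow_comp_mul {h : ℝ → ℝ} {q r t : ℝ} (hr : 0 < r) :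
    ∫ s in (0:ℝ)..r * t, h s / s ^ q = r * ∫ s in (0:ℝ)..t, h (r * s) / (r * s) ^ q := by
  have := intervalIntegral.integral_comp_mul_left (a := 0) (b := t)
    (fun s => h s / s ^ q) hr.ne'
  rw [this, mul_zero, smul_eq_mul, mul_inv_cancel_left₀ hr.ne']

theorem intervalIntegrable_comp_mul_of_pos {g : ℝ → ℝ} {r t : ℝ} (hr : 0 < r)
    (hg : IntervalIntegrable g volume 0 (r * t)) :
    IntervalIntegrable (fun s => g (r * s)) volume 0 t := by
  have := hg.comp_mul_left (c := r)
  rwa [zero_div, mul_div_cancel_left₀ _ hr.ne'] at this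

theorem mul_rpow_mul_div_rpow {r s a q H : ℝ} (hr : 0 < r) (hs : 0 ≤ s) :
    r * (r ^ a * H / (r * s) ^ q) = r ^ (1 + a - q) * (H / s ^ q) := by
  rw [Real.mul_rpow hr.le hs, Real.rpow_sub hr, Real.rpow_add hr, Real.rpow_one]
  simp only [div_eq_mul_inv, mul_inv]
  ring

theorem integral_div_rpow_mul_le {h : ℝ → ℝ} {a q r t : ℝ} (hr : 0 < r) (ht : 0 ≤ t)
    (hi : ∀ x, 0 ≤ x → IntervalIntegrable (fun s => h s / s ^ q) volume 0 x)
    (hle : ∀ s, 0 ≤ s → h (r * s) ≤ r ^ a * h s) :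
    ∫ s in (0:ℝ)..r * t, h s / s ^ q ≤ r ^ (1 + a - q) * ∫ s in (0:ℝ)..t, h s / s ^ q := by
  rw [integral_div_rpow_comp_mul hr, ← intervalIntegral.integral_const_mul,
    ← intervalIntegral.integral_const_mul]
  refine intervalIntegral.integral_mono_on ht
    ((intervalIntegrable_comp_mul_of_pos hr (hi _ (mul_nonneg hr.le ht))).const_mul r)
    ((hi t ht).const_mul _) fun s hs => ?_
  rw [← mul_rpow_mul_div_rpow hr hs.1]
  have := hle s hs.1
  have := mul_nonneg hr.le hs.1
  gcongr

theorem le_integral_div_rpow_mul {h : ℝ → ℝ} {a q r t : ℝ} (hr : 0 < r) (ht : 0 ≤ t)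
    (hi : ∀ x, 0 ≤ x → IntervalIntegrable (fun s => h s / s ^ q) volume 0 x)
    (hle : ∀ s, 0 ≤ s → r ^ a * h s ≤ h (r * s)) :
    r ^ (1 + a - q) * ∫ s in (0:ℝ)..t, h s / s ^ q ≤ ∫ s in (0:ℝ)..r * t, h s / s ^ q := by
  have := integral_div_rpow_mul_le (h := fun s => -h s) hr ht
    (fun x hx => by simpa only [neg_div] using! (hi x hx).neg)
    (fun s hs => by linarith [hle s hs])
  simp only [neg_div, intervalIntegral.integral_neg] at this
  linarith

/-- Power scaling bounds for factors `ρ ≥ 1` extend to all `ρ ≥ 0`. -/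
theorem min_rpow_mul_le_and_le_max_rpow_mul {B : ℝ → ℝ} {p q : ℝ} (hp : 0 < p) (hq : 0 < q)
    (hB0 : B 0 = 0) (hB : Set.MapsTo B (Set.Ici 0) (Set.Ici 0))
    (hlow : ∀ r t, 1 ≤ r → 0 ≤ t → r ^ p * B t ≤ B (r * t))
    (hup : ∀ r t, 1 ≤ r → 0 ≤ t → B (r * t) ≤ r ^ q * B t)
    {ρ t : ℝ} (hρ : 0 ≤ ρ) (ht : 0 ≤ t) :
    min (ρ ^ p) (ρ ^ q) * B t ≤ B (ρ * t) ∧ B (ρ * t) ≤ max (ρ ^ p) (ρ ^ q) * B t := by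
  have hBt : 0 ≤ B t := hB ht
  rcases hρ.eq_or_lt with rfl | hρ
  · simp [Real.zero_rpow hp.ne', Real.zero_rpow hq.ne', hB0]
  suffices ∃ a b, min (ρ ^ p) (ρ ^ q) ≤ a ∧ b ≤ max (ρ ^ p) (ρ ^ q) ∧
      a * B t ≤ B (ρ * t) ∧ B (ρ * t) ≤ b * B t by
    obtain ⟨a, b, ha, hb, h1, h2⟩ := this
    exact ⟨(mul_le_mul_of_nonneg_right ha hBt).trans h1,
      h2.trans (mul_le_mul_of_nonneg_right hb hBt)⟩
  rcases le_total 1 ρ with h1 | h1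
  · exact ⟨_, _, min_le_left _ _, le_max_right _ _, hlow ρ t h1 ht, hup ρ t h1 ht⟩
  · have hinv : 1 ≤ ρ⁻¹ := (one_le_inv₀ hρ).2 h1
    have e : ρ⁻¹ * (ρ * t) = t := inv_mul_cancel_left₀ hρ.ne' t
    have h2 := hlow ρ⁻¹ (ρ * t) hinv (mul_nonneg hρ.le ht)
    have h3 := hup ρ⁻¹ (ρ * t) hinv (mul_nonneg hρ.le ht)
    rw [e, Real.inv_rpow hρ.le, inv_mul_le_iff₀ (Real.rpow_pos_of_pos hρ _)] at h2
    rw [e, Real.inv_rpow hρ.le, le_inv_mul_iff₀ (Real.rpow_pos_of_pos hρ _)] at h3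
    exact ⟨_, _, min_le_right _ _, le_max_left _ _, h3, h2⟩

/-- Lemma 2.5 (Fukagai–Narukawa): scaling estimate for the Sobolev conjugate `Φ_*`:
`min(ρ^{l*}, ρ^{m*}) Φ_*(t) ≤ Φ_*(ρt) ≤ max(ρ^{l*}, ρ^{m*}) Φ_*(t)` for `ρ, t ≥ 0`,
where `l* = lN/(N-l)` and `m* = mN/(N-m)`. -/
theorem conjugate_scaling_estimate (N : ℕ) (hN : 2 ≤ N) (φfun : ℝ → ℝ)
    (hφc : ContinuousOn φfun (Set.Ioi 0))
    (hφpos : ∀ t, 0 < t → 0 < φfun t)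
    (hφmono : StrictMonoOn (fun t => t * φfun t) (Set.Ioi 0))
    (hφ0 : Tendsto (fun t => t * φfun t) (𝓝[>] (0 : ℝ)) (𝓝 0))
    (hφinf : Tendsto (fun t => t * φfun t) atTop atTop)
    (Φ : ℝ → ℝ) (hΦdef : ∀ t, Φ t = ∫ s in (0:ℝ)..|t|, s * φfun s)
    (l m : ℝ) (hl : 1 ≤ l) (hlm : l ≤ m) (hlN : l < N) (hmN : m < N)
    (hsand : ∀ t, 0 < t → l ≤ t ^ 2 * φfun t / Φ t ∧ t ^ 2 * φfun t / Φ t ≤ m)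
    (Φinv : ℝ → ℝ) (hΦinvmap : Set.MapsTo Φinv (Set.Ici 0) (Set.Ici 0))
    (hΦinv : Set.InvOn Φinv Φ (Set.Ici 0) (Set.Ici 0))
    (hdiv : Tendsto (fun T => ∫ s in (1:ℝ)..T, Φinv s / s ^ (((N : ℝ) + 1) / N))
      atTop atTop)
    (G : ℝ → ℝ)
    (hG : ∀ t, 0 ≤ t → G t = ∫ s in (0:ℝ)..t, Φinv s / s ^ (((N : ℝ) + 1) / N))
    (Φstar : ℝ → ℝ)
    (hstarmono : StrictMonoOn Φstar (Set.Ici 0))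
    (hstarbij : Set.BijOn Φstar (Set.Ici 0) (Set.Ici 0))
    (hstarinv : Set.InvOn Φstar G (Set.Ici 0) (Set.Ici 0)) :
    ∀ ρ ≥ (0:ℝ), ∀ t ≥ (0:ℝ),
      min (ρ ^ (l * N / ((N : ℝ) - l))) (ρ ^ (m * N / ((N : ℝ) - m))) * Φstar t ≤
          Φstar (ρ * t) ∧
        Φstar (ρ * t) ≤
          max (ρ ^ (l * N / ((N : ℝ) - l))) (ρ ^ (m * N / ((N : ℝ) - m))) * Φstar t := by
  have hfmono : MonotoneOn (fun t => t * φfun t) (Set.Ici 0) := by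
    intro x hx y hy hxy
    rcases (Set.mem_Ici.1 hx).eq_or_lt with rfl | hx0
    · rcases (Set.mem_Ici.1 hy).eq_or_lt with rfl | hy0
      · exact le_rfl
      · simpa using (mul_pos hy0 (hφpos y hy0)).le
    · exact hφmono.monotoneOn hx0 (hx0.trans_le hxy) hxy
  have hfint : ∀ t, 0 ≤ t → IntervalIntegrable (fun s => s * φfun s) volume 0 t := by
    intro t ht
    refine MonotoneOn.intervalIntegrable (hfmono.mono ?_)
    rw [Set.uIcc_of_le ht]
    exact Set.Icc_subset_Ici_self
  have hΦeq : ∀ t, 0 ≤ t → Φ t = ∫ s in (0:ℝ)..t, s * φfun s := by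
    intro t ht
    rw [hΦdef, abs_of_nonneg ht]
  have hΦ0 : Φ 0 = 0 := by simp [hΦdef]
  have hΦnn : ∀ t, 0 ≤ t → 0 ≤ Φ t := by
    intro t ht
    rw [hΦeq t ht]
    refine intervalIntegral.integral_nonneg ht fun s hs => ?_
    simpa using hfmono (Set.self_mem_Ici) (Set.mem_Ici.2 hs.1) hs.1
  have hΦpos : ∀ t, 0 < t → 0 < Φ t := by
    intro t ht
    refine (hΦnn t ht.le).lt_of_ne' fun h => ?_
    have := (hsand t ht).1
    rw [h, _root_.div_zero] at this
    linarith
  have hcont : ContinuousOn (fun s => s * φfun s) (Set.Ioi 0) := continuousOn_id.mul hφc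
  have hderiv : ∀ t, 0 < t → HasDerivAt Φ (t * φfun t) t := by
    intro t ht
    have hd := intervalIntegral.integral_hasDerivAt_right (hfint t ht.le)
      (hcont.stronglyMeasurableAtFilter isOpen_Ioi t ht)
      (hcont.continuousAt (Ioi_mem_nhds ht))
    refine hd.congr_of_eventuallyEq ?_
    filter_upwards [Ioi_mem_nhds ht] with x hx using hΦeq x (Set.mem_Ioi.1 hx).le
  have hΦlow : ∀ r t, 1 ≤ r → 0 ≤ t → r ^ l * Φ t ≤ Φ (r * t) := by
    intro r t hr ht
    rcases ht.eq_or_lt with rfl | ht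
    · simp [hΦ0]
    refine rpow_mul_le_of_mul_le_mul_deriv hderiv (fun t ht => ?_) hr ht
    have := (le_div_iff₀ (hΦpos t ht)).1 (hsand t ht).1
    linarith
  have hΦup : ∀ r t, 1 ≤ r → 0 ≤ t → Φ (r * t) ≤ r ^ m * Φ t := by
    intro r t hr ht
    rcases ht.eq_or_lt with rfl | ht
    · simp [hΦ0]
    refine mul_le_rpow_mul_of_mul_deriv_le hderiv (fun t ht => ?_) hr ht
    have := (div_le_iff₀ (hΦpos t ht)).1 (hsand t ht).2
    linarith
  have hΦmono : MonotoneOn Φ (Set.Ici 0) := by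
    intro x hx y hy hxy
    rcases (Set.mem_Ici.1 hx).eq_or_lt with rfl | hx0
    · simpa [hΦ0] using hΦnn y hy
    have hr : 1 ≤ y / x := (one_le_div hx0).2 hxy
    have h := hΦlow (y / x) x hr hx
    rw [div_mul_cancel₀ _ hx0.ne'] at h
    exact (le_mul_of_one_le_left (hΦnn x hx)
      (Real.one_le_rpow hr (zero_le_one.trans hl))).trans h
  have hl0 : 0 < l := by linarith
  have hm0 : 0 < m := by linarith
  have hN0 : (0 : ℝ) < N := by linarith
  have hΦinvmono := monotoneOn_of_rightInvOn hΦmono hΦinvmap hΦinv.2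
  have hΦmap : Set.MapsTo Φ (Set.Ici 0) (Set.Ici 0) := hΦnn
  have hinvup : ∀ r s, 1 ≤ r → 0 ≤ s → Φinv (r * s) ≤ r ^ l⁻¹ * Φinv s := fun r s hr hs =>
    inverse_mul_le_rpow_mul hl0 hΦinvmono hΦmap hΦinvmap hΦinv hΦlow hr hs
  have hinvlow : ∀ r s, 1 ≤ r → 0 ≤ s → r ^ m⁻¹ * Φinv s ≤ Φinv (r * s) := fun r s hr hs =>
    rpow_mul_le_inverse_mul hm0 hΦinvmono hΦmap hΦinvmap hΦinv hΦup hr hs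
  have hGmap : Set.MapsTo G (Set.Ici 0) (Set.Ici 0) := by
    intro t ht
    have ht : 0 ≤ t := ht
    rw [Set.mem_Ici, hG t ht]
    exact intervalIntegral.integral_nonneg ht fun s hs =>
      div_nonneg (hΦinvmap hs.1) (Real.rpow_nonneg hs.1 _)
  have hG0 : G 0 = 0 := by simp [hG 0 le_rfl]
  have hstar0 : Φstar 0 = 0 := by
    have := hstarinv.1 (Set.self_mem_Ici (a := (0 : ℝ)))
    rwa [hG0] at this
  -- A divergent integral would be `0`, contradicting the injectivity of `G`.
  have hGint : ∀ x, 0 ≤ x →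
      IntervalIntegrable (fun s => Φinv s / s ^ (((N : ℝ) + 1) / N)) volume 0 x := by
    intro x hx
    by_contra hni
    have hGx : G x = 0 := by rw [hG x hx, intervalIntegral.integral_undef hni]
    have hx0 : Φstar (G x) = x := hstarinv.1 hx
    rw [hGx, hstar0] at hx0
    subst hx0
    exact hni IntervalIntegrable.refl
  have hexp : ∀ p : ℝ, 0 < p → p < N →
      0 < p * N / ((N : ℝ) - p) ∧ 0 < 1 + p⁻¹ - ((N : ℝ) + 1) / N ∧
        (1 + p⁻¹ - ((N : ℝ) + 1) / N)⁻¹ = p * N / ((N : ℝ) - p) := by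
    intro p hp hpN
    have hsub : 0 < (N : ℝ) - p := sub_pos.2 hpN
    have e : 1 + p⁻¹ - ((N : ℝ) + 1) / N = (p * N / ((N : ℝ) - p))⁻¹ := by
      field_simp
      ring
    have hpos : 0 < p * N / ((N : ℝ) - p) := by positivity
    exact ⟨hpos, e ▸ inv_pos.2 hpos, by rw [e, inv_inv]⟩
  obtain ⟨hlpos, hlexp, hlinv⟩ := hexp l hl0 hlN
  obtain ⟨hmpos, hmexp, hminv⟩ := hexp m hm0 hmN
  have hGup : ∀ r t, 1 ≤ r → 0 ≤ t →
      G (r * t) ≤ r ^ (1 + l⁻¹ - ((N : ℝ) + 1) / N) * G t := by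
    intro r t hr ht
    have hr0 : 0 < r := by linarith
    rw [hG t ht, hG _ (mul_nonneg hr0.le ht)]
    exact integral_div_rpow_mul_le hr0 ht hGint (hinvup r · hr)
  have hGlow : ∀ r t, 1 ≤ r → 0 ≤ t →
      r ^ (1 + m⁻¹ - ((N : ℝ) + 1) / N) * G t ≤ G (r * t) := by
    intro r t hr ht
    have hr0 : 0 < r := by linarith
    rw [hG t ht, hG _ (mul_nonneg hr0.le ht)]
    exact le_integral_div_rpow_mul hr0 ht hGint (hinvlow r · hr)
  intro ρ hρ t ht
  refine min_rpow_mul_le_and_le_max_rpow_mul hlpos hmpos hstar0 hstarbij.mapsTo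
    (fun r t hr ht => ?_) (fun r t hr ht => ?_) hρ ht
  · rw [← hlinv]
    exact rpow_mul_le_inverse_mul hlexp hstarmono.monotoneOn hGmap hstarbij.mapsTo hstarinv
      hGup hr ht
  · rw [← hminv]
    exact inverse_mul_le_rpow_mul hmexp hstarmono.monotoneOn hGmap hstarbij.mapsTo hstarinv
      hGlow hr ht
end
end

section
/- Let Φ be an N-function and let (w_n) be a sequence of measurable functions ℝ^N → ℝ that is bounded in L^Φ(ℝ^N), i.e. there is C > 0 with ∫_{ℝ^N} Φ(|w_n|/C) dx ≤ 1 for all n, and suppose w_n(x) → w(x) for Lebesgue-almost every x ∈ ℝ^N. Then: (a) w ∈ L^Φ(ℝ^N), i.e. there is α > 0 with ∫_{ℝ^N} Φ(|w|/α) dx < ∞; and (b) for every compactly supported smooth function v : ℝ^N → ℝ, ∫_{ℝ^N} w_n v dx → ∫_{ℝ^N} w v dx as n → ∞. -/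
open MeasureTheory Filter Topology ENNReal

noncomputable section

/-- A superlinear function dominates the identity up to a constant and an arbitrarily small
factor. -/
theorem exists_le_add_mul_of_superlinear {Φ : ℝ → ℝ} (hΦ0 : ∀ t, 0 ≤ Φ t)
    (hΦ : Tendsto (fun t => Φ t / t) atTop atTop) {C ε : ℝ} (hC : 0 < C) (hε : 0 < ε) :
    ∃ T, 0 < T ∧ ∀ t, t ≤ T + ε * Φ (t / C) := by
  obtain ⟨S, hS⟩ := eventually_atTop.1 (hΦ.eventually_ge_atTop (C / ε))
  refine ⟨C * max S 1, by positivity, fun t => ?_⟩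
  rcases le_total (t / C) (max S 1) with h | h
  · have h1 : t ≤ C * max S 1 := by rwa [div_le_iff₀' hC] at h
    have h2 := mul_nonneg hε.le (hΦ0 (t / C))
    linarith
  · have hpos : 0 < t / C := lt_of_lt_of_le (by positivity) h
    have h1 := hS _ ((le_max_left _ _).trans h)
    rw [le_div_iff₀ hpos, div_mul_div_comm, mul_comm ε C, mul_div_mul_left _ _ hC.ne',
      div_le_iff₀' hε] at h1
    have h2 : 0 < C * max S 1 := by positivity
    linarith

/-- A modular bound `∫ Φ(|f|/C) ≤ 1` controls `∫_s |f|` uniformly in `f`. -/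
theorem exists_setLIntegral_enorm_le {α : Type*} [MeasurableSpace α] {Φ : ℝ → ℝ}
    (hΦ0 : ∀ t, 0 ≤ Φ t) (hΦ : Tendsto (fun t => Φ t / t) atTop atTop)
    {C ε : ℝ} (hC : 0 < C) (hε : 0 < ε) :
    ∃ T : ℝ, 0 < T ∧ ∀ (μ : Measure α) (f : α → ℝ),
      ∫⁻ x, ENNReal.ofReal (Φ (|f x| / C)) ∂μ ≤ 1 → ∀ s : Set α,
        ∫⁻ x in s, ‖f x‖ₑ ∂μ ≤ ENNReal.ofReal T * μ s + ENNReal.ofReal ε := by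
  obtain ⟨T, hT, hle⟩ := exists_le_add_mul_of_superlinear hΦ0 hΦ hC hε
  refine ⟨T, hT, fun μ f hf s => ?_⟩
  calc ∫⁻ x in s, ‖f x‖ₑ ∂μ
      ≤ ∫⁻ x in s, (ENNReal.ofReal T + ENNReal.ofReal ε * ENNReal.ofReal (Φ (|f x| / C))) ∂μ := by
        refine lintegral_mono fun x => ?_
        rw [← ENNReal.ofReal_mul hε.le,
          ← ENNReal.ofReal_add hT.le (mul_nonneg hε.le (hΦ0 _)), Real.enorm_eq_ofReal_abs]
        exact ENNReal.ofReal_le_ofReal (hle _)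
    _ = ENNReal.ofReal T * μ s
          + ENNReal.ofReal ε * ∫⁻ x in s, ENNReal.ofReal (Φ (|f x| / C)) ∂μ := by
        rw [lintegral_add_left measurable_const, setLIntegral_const,
          lintegral_const_mul' _ _ ENNReal.ofReal_ne_top]
    _ ≤ ENNReal.ofReal T * μ s + ENNReal.ofReal ε * 1 := by
        gcongr
        exact (setLIntegral_le_lintegral _ _).trans hf
    _ = ENNReal.ofReal T * μ s + ENNReal.ofReal ε := by rw [mul_one]

/-- De la Vallée Poussin: a modular bound for a superlinear function implies uniform
integrability. -/
theorem unifIntegrable_of_modular_le {α ι : Type*} [MeasurableSpace α] {μ : Measure α}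
    {Φ : ℝ → ℝ} (hΦ0 : ∀ t, 0 ≤ Φ t) (hΦ : Tendsto (fun t => Φ t / t) atTop atTop)
    {C : ℝ} (hC : 0 < C) {f : ι → α → ℝ}
    (hf : ∀ i, ∫⁻ x, ENNReal.ofReal (Φ (|f i x| / C)) ∂μ ≤ 1) :
    UnifIntegrable f 1 μ := by
  intro ε hε
  obtain ⟨T, hT, hle⟩ := exists_setLIntegral_enorm_le (α := α) hΦ0 hΦ hC (half_pos hε)
  refine ⟨ε / 2 / T, by positivity, fun i s hs hμs => ?_⟩
  rw [eLpNorm_indicator_eq_eLpNorm_restrict hs, eLpNorm_one_eq_lintegral_enorm]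
  calc ∫⁻ x in s, ‖f i x‖ₑ ∂μ
      ≤ ENNReal.ofReal T * μ s + ENNReal.ofReal (ε / 2) := hle μ (f i) (hf i) s
    _ ≤ ENNReal.ofReal T * ENNReal.ofReal (ε / 2 / T) + ENNReal.ofReal (ε / 2) := by gcongr
    _ = ENNReal.ofReal ε := by
        rw [← ENNReal.ofReal_mul hT.le, mul_div_cancel₀ _ hT.ne',
          ← ENNReal.ofReal_add (by positivity) (by positivity), add_halves]

/-- On a finite measure space, a modular bound for a superlinear function implies
integrability. -/
theorem memLp_one_of_modular_le {α : Type*} [MeasurableSpace α] {μ : Measure α}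
    [IsFiniteMeasure μ] {Φ : ℝ → ℝ} (hΦ0 : ∀ t, 0 ≤ Φ t)
    (hΦ : Tendsto (fun t => Φ t / t) atTop atTop) {C : ℝ} (hC : 0 < C) {f : α → ℝ}
    (hfm : AEStronglyMeasurable f μ)
    (hf : ∫⁻ x, ENNReal.ofReal (Φ (|f x| / C)) ∂μ ≤ 1) : MemLp f 1 μ := by
  obtain ⟨T, -, hle⟩ := exists_setLIntegral_enorm_le (α := α) hΦ0 hΦ hC one_pos
  have h := hle μ f hf Set.univ
  rw [Measure.restrict_univ] at h
  refine ⟨hfm, ?_⟩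
  rw [eLpNorm_one_eq_lintegral_enorm]
  exact h.trans_lt (ENNReal.add_lt_top.2
    ⟨ENNReal.mul_lt_top ENNReal.ofReal_lt_top (measure_lt_top μ _), ENNReal.ofReal_lt_top⟩)

/-- The modular is lower semicontinuous under almost everywhere convergence. -/
theorem modular_le_of_tendsto_ae {α : Type*} [MeasurableSpace α] {μ : Measure α}
    {Φ : ℝ → ℝ} (hΦ : Continuous Φ) {C : ℝ} {K : ℝ≥0∞} {f : ℕ → α → ℝ} {g : α → ℝ}
    (hfm : ∀ n, Measurable (f n))
    (hf : ∀ n, ∫⁻ x, ENNReal.ofReal (Φ (|f n x| / C)) ∂μ ≤ K)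
    (hfg : ∀ᵐ x ∂μ, Tendsto (fun n => f n x) atTop (𝓝 (g x))) :
    ∫⁻ x, ENNReal.ofReal (Φ (|g x| / C)) ∂μ ≤ K := by
  have hcont : Continuous fun t : ℝ => ENNReal.ofReal (Φ (|t| / C)) :=
    ENNReal.continuous_ofReal.comp (by fun_prop)
  calc ∫⁻ x, ENNReal.ofReal (Φ (|g x| / C)) ∂μ
      = ∫⁻ x, liminf (fun n => ENNReal.ofReal (Φ (|f n x| / C))) atTop ∂μ := by
        refine lintegral_congr_ae ?_
        filter_upwards [hfg] with x hx
        exact (((hcont.tendsto (g x)).comp hx).liminf_eq).symm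
    _ ≤ liminf (fun n => ∫⁻ x, ENNReal.ofReal (Φ (|f n x| / C)) ∂μ) atTop :=
        lintegral_liminf_le fun n => hcont.measurable.comp (hfm n)
    _ ≤ K := liminf_le_of_le (by isBoundedDefault) fun b hb => by
        obtain ⟨n, hn⟩ := hb.exists
        exact hn.trans (hf n)

/-- If `f n → g` in `L¹` then `∫ f n * v → ∫ g * v` for every bounded `v`. -/
theorem tendsto_integral_mul_of_tendsto_eLpNorm {α : Type*} [MeasurableSpace α] {μ : Measure α}
    {f : ℕ → α → ℝ} {g v : α → ℝ} {M : ℝ} (hf : ∀ n, MemLp (f n) 1 μ) (hg : MemLp g 1 μ)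
    (hfg : Tendsto (fun n => eLpNorm (f n - g) 1 μ) atTop (𝓝 0))
    (hvm : AEStronglyMeasurable v μ) (hv : ∀ x, ‖v x‖ ≤ M) :
    Tendsto (fun n => ∫ x, f n x * v x ∂μ) atTop (𝓝 (∫ x, g x * v x ∂μ)) := by
  have hint : ∀ {h : α → ℝ}, MemLp h 1 μ → Integrable (fun x => h x * v x) μ := fun hh =>
    (memLp_one_iff_integrable.1 hh).mul_bdd hvm (ae_of_all _ hv)
  refine tendsto_integral_of_L1' _ (hint hg).aestronglyMeasurable (Eventually.of_forall fun n => hint (hf n)) ?_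
  have hlim : Tendsto (fun n => ENNReal.ofReal M * eLpNorm (f n - g) 1 μ) atTop (𝓝 0) := by
    simpa using ENNReal.Tendsto.const_mul hfg (Or.inr ENNReal.ofReal_ne_top)
  refine tendsto_of_tendsto_of_tendsto_of_le_of_le tendsto_const_nhds hlim
    (fun _ => zero_le) fun n => ?_
  refine eLpNorm_le_mul_eLpNorm_of_ae_le_mul (ae_of_all _ fun x => ?_) 1
  simp only [Pi.sub_apply]
  rw [← sub_mul, norm_mul, mul_comm]
  gcongr
  exact hv x

/-- Lemma 2.6 (almost weak convergence in `L^Φ(ℝ^N)`): if `(w_n)` is bounded in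
`L^Φ(ℝ^N)` and `w_n → w` a.e., then `w ∈ L^Φ(ℝ^N)` and `∫ w_n v → ∫ w v` for every
compactly supported smooth `v`. -/
theorem almost_weak_convergence (N : ℕ) (Φ : ℝ → ℝ) (hΦ : IsNFunction Φ)
    (w : ℕ → EuclideanSpace ℝ (Fin N) → ℝ) (hw : ∀ n, Measurable (w n))
    (wlim : EuclideanSpace ℝ (Fin N) → ℝ)
    (C : ℝ) (hC : 0 < C)
    (hbdd : ∀ n, ∫⁻ x, ENNReal.ofReal (Φ (|w n x| / C)) ≤ 1)
    (hae : ∀ᵐ x, Tendsto (fun n => w n x) atTop (𝓝 (wlim x))) :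
    (∃ α : ℝ, 0 < α ∧ (∫⁻ x, ENNReal.ofReal (Φ (|wlim x| / α))) < ⊤) ∧
      ∀ v : EuclideanSpace ℝ (Fin N) → ℝ, ContDiff ℝ (⊤ : ℕ∞) v → HasCompactSupport v →
        Tendsto (fun n => ∫ x, w n x * v x) atTop (𝓝 (∫ x, wlim x * v x)) := by
  obtain ⟨hcont, -, hΦ0, -, -, -, hsup⟩ := hΦ
  have hlim := modular_le_of_tendsto_ae hcont hw hbdd hae
  refine ⟨⟨C, hC, hlim.trans_lt ENNReal.one_lt_top⟩, fun v hv hvs => ?_⟩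
  obtain ⟨M, hM⟩ := hvs.exists_bound_of_continuous hv.continuous
  set K := tsupport v
  have : IsFiniteMeasure (volume.restrict K) := ⟨by simpa using hvs.measure_lt_top⟩
  have hrestrict : ∀ h : EuclideanSpace ℝ (Fin N) → ℝ,
      ∫ x in K, h x * v x = ∫ x, h x * v x := fun h =>
    setIntegral_eq_integral_of_forall_compl_eq_zero fun x hx => by
      rw [image_eq_zero_of_notMem_tsupport hx, mul_zero]
  have hbddK : ∀ n, ∫⁻ x in K, ENNReal.ofReal (Φ (|w n x| / C)) ≤ 1 := fun n =>
    (setLIntegral_le_lintegral _ _).trans (hbdd n)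
  have haeK := ae_restrict_of_ae (s := K) hae
  have hwK : ∀ n, AEStronglyMeasurable (w n) (volume.restrict K) := fun n =>
    (hw n).aestronglyMeasurable
  have hg : MemLp wlim 1 (volume.restrict K) :=
    memLp_one_of_modular_le hΦ0 hsup hC (aestronglyMeasurable_of_tendsto_ae _ hwK haeK)
      ((setLIntegral_le_lintegral _ _).trans hlim)
  simp only [← hrestrict]
  exact tendsto_integral_mul_of_tendsto_eLpNorm
    (fun n => memLp_one_of_modular_le hΦ0 hsup hC (hwK n) (hbddK n)) hg
    (tendsto_Lp_finite_of_tendsto_ae le_rfl ENNReal.one_ne_top hwK hg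
      (unifIntegrable_of_modular_le hΦ0 hsup hC hbddK) haeK)
    hv.continuous.aestronglyMeasurable hM
end
end

section
/- Let φ, b : (0,∞) → (0,∞) be continuous functions and set Φ(t) = ∫_0^{|t|} s φ(s) ds and B(t) = ∫_0^{|t|} s b(s) ds, assuming both are N-functions with B(t) > 0 for t ≠ 0. Let f : ℝ → ℝ be continuous with lim_{t→0} |f(t)|/(|t| φ(|t|)) = 0 and limsup_{|t|→∞} |f(t)|/(|t| b(|t|)) < ∞, and let F(t) = ∫_0^t f(s) ds. Then for every ε > 0 there exists C_ε > 0 such that |F(t)| ≤ ε Φ(|t|) + C_ε B(|t|) for all t ∈ ℝ. -/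
open MeasureTheory Filter Topology ENNReal

noncomputable section

/-- A function that is `o(p)` near `0` and `O(q)` at infinity is bounded by `ε p + K q`. -/
theorem exists_bound_add_of_tendsto_div_zero {f p q : ℝ → ℝ} (hf : Continuous f)
    (hp : ∀ s, 0 < s → 0 < p s) (hq : ∀ s, 0 < s → 0 < q s) (hqc : ContinuousOn q (Set.Ioi 0))
    (hzero : Tendsto (fun t => |f t| / p |t|) (𝓝[≠] (0 : ℝ)) (𝓝 0))
    (hinfty : ∃ C T : ℝ, ∀ t : ℝ, T ≤ |t| → |f t| ≤ C * q |t|) {ε : ℝ} (hε : 0 < ε) :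
    ∃ K : ℝ, 0 < K ∧ ∀ x : ℝ, x ≠ 0 → |f x| ≤ ε * p |x| + K * q |x| := by
  obtain ⟨C, T, hC⟩ := hinfty
  have hev := hzero.eventually (gt_mem_nhds hε)
  rw [eventually_nhdsWithin_iff, Metric.eventually_nhds_iff] at hev
  obtain ⟨δ, hδ, hnear⟩ := hev
  have hcompact : IsCompact (Metric.closedBall (0 : ℝ) T \ Metric.ball 0 δ) :=
    (isCompact_closedBall 0 T).diff Metric.isOpen_ball
  have hcont : ContinuousOn (fun x => f x / q |x|)
      (Metric.closedBall (0 : ℝ) T \ Metric.ball 0 δ) := by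
    have habs : ∀ x ∈ Metric.closedBall (0 : ℝ) T \ Metric.ball 0 δ, 0 < |x| := by
      rintro x ⟨-, hx⟩
      rw [mem_ball_zero_iff, not_lt, Real.norm_eq_abs] at hx
      exact hδ.trans_le hx
    exact hf.continuousOn.div (hqc.comp continuous_abs.continuousOn habs)
      fun x hx => (hq _ (habs x hx)).ne'
  obtain ⟨M, hM⟩ := hcompact.exists_bound_of_continuousOn hcont
  refine ⟨max (max C M) 1, by positivity, fun x hx => ?_⟩
  have hx' : 0 < |x| := abs_pos.mpr hx
  have hpx := hp _ hx'
  have hqx := hq _ hx'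
  have hεp : 0 < ε * p |x| := mul_pos hε hpx
  have hle : ∀ A, A ≤ max (max C M) 1 → |f x| ≤ A * q |x| →
      |f x| ≤ ε * p |x| + max (max C M) 1 * q |x| := fun A hA h => by
    have := mul_le_mul_of_nonneg_right hA hqx.le
    linarith
  by_cases hxδ : |x| < δ
  · have h := hnear (y := x) (by simpa using hxδ) hx
    rw [div_lt_iff₀ hpx] at h
    have : 0 < max (max C M) 1 * q |x| := by positivity
    linarith
  · rcases le_total T |x| with hT | hT
    · exact hle C ((le_max_left _ _).trans (le_max_left _ _)) (hC x hT)
    · refine hle M ((le_max_right _ _).trans (le_max_left _ _)) ?_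
      have h := hM x ⟨by simpa using hT, by simpa using hxδ⟩
      rwa [Real.norm_eq_abs, abs_div, abs_of_pos hqx, div_le_iff₀ hqx] at h

/-- Integrated form of a pointwise bound `|f| ≤ ε p + K q` on `(0, ∞)`. -/
theorem abs_integral_le_add_of_abs_le {f p q : ℝ → ℝ} {t ε K : ℝ} (ht : 0 ≤ t)
    (hp : IntervalIntegrable p volume 0 t) (hq : IntervalIntegrable q volume 0 t)
    (h : ∀ s, 0 < s → |f s| ≤ ε * p s + K * q s) :
    |∫ s in (0:ℝ)..t, f s| ≤ ε * (∫ s in (0:ℝ)..t, p s) + K * ∫ s in (0:ℝ)..t, q s := by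
  rw [← intervalIntegral.integral_const_mul, ← intervalIntegral.integral_const_mul,
    ← intervalIntegral.integral_add (hp.const_mul ε) (hq.const_mul K)]
  exact intervalIntegral.norm_integral_le_of_norm_le ht
    (Eventually.of_forall fun s hs => (Real.norm_eq_abs (f s)).trans_le (h s hs.1))
    ((hp.const_mul ε).add (hq.const_mul K))

/-- A function whose primitive vanishes only at `0` is integrable on every `[0, |t|]`. -/
theorem intervalIntegrable_of_primitive_eq_zero_iff {p P : ℝ → ℝ}
    (hP : ∀ t, P t = ∫ s in (0:ℝ)..|t|, p s) (hP0 : ∀ t, P t = 0 ↔ t = 0) (t : ℝ) :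
    IntervalIntegrable p volume 0 |t| := by
  by_contra h
  obtain rfl := (hP0 t).1 ((hP t).trans (intervalIntegral.integral_undef h))
  simp at h

/-- The growth estimate (4.4): under `(f₁)` and `(f₂)`, for every `ε > 0` there is
`C_ε > 0` with `|F(t)| ≤ ε Φ(|t|) + C_ε B(|t|)` for all `t`. -/
theorem primitive_growth_estimate (φfun b : ℝ → ℝ)
    (hφc : ContinuousOn φfun (Set.Ioi 0)) (hbc : ContinuousOn b (Set.Ioi 0))
    (hφpos : ∀ t, 0 < t → 0 < φfun t) (hbpos : ∀ t, 0 < t → 0 < b t)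
    (Φ B : ℝ → ℝ)
    (hΦdef : ∀ t, Φ t = ∫ s in (0:ℝ)..|t|, s * φfun s)
    (hBdef : ∀ t, B t = ∫ s in (0:ℝ)..|t|, s * b s)
    (hΦN : IsNFunction Φ) (hBN : IsNFunction B)
    (hBpos : ∀ t : ℝ, t ≠ 0 → 0 < B t)
    (f : ℝ → ℝ) (hf : Continuous f)
    (hf1 : Tendsto (fun t => |f t| / (|t| * φfun |t|)) (𝓝[≠] (0 : ℝ)) (𝓝 0))
    (hf2 : ∃ C T : ℝ, 0 < T ∧ ∀ t : ℝ, T ≤ |t| → |f t| ≤ C * (|t| * b |t|))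
    (F : ℝ → ℝ) (hFdef : ∀ t, F t = ∫ s in (0:ℝ)..t, f s) :
    ∀ ε : ℝ, 0 < ε → ∃ Cε : ℝ, 0 < Cε ∧
      ∀ t : ℝ, |F t| ≤ ε * Φ |t| + Cε * B |t| := by
  intro ε hε
  obtain ⟨C, T, -, hC⟩ := hf2
  obtain ⟨K, hK, hbound⟩ := exists_bound_add_of_tendsto_div_zero (p := fun s => s * φfun s)
    (q := fun s => s * b s) hf (fun s hs => mul_pos hs (hφpos s hs))
    (fun s hs => mul_pos hs (hbpos s hs)) (continuousOn_id.mul hbc) hf1 ⟨C, T, hC⟩ hε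
  refine ⟨K, hK, fun t => ?_⟩
  have hp := intervalIntegrable_of_primitive_eq_zero_iff hΦdef hΦN.2.2.2.1 t
  have hq := intervalIntegrable_of_primitive_eq_zero_iff hBdef hBN.2.2.2.1 t
  rw [hFdef, hΦdef, hBdef, abs_abs]
  rcases le_total 0 t with ht | ht
  · rw [abs_of_nonneg ht] at hp hq ⊢
    refine abs_integral_le_add_of_abs_le ht hp hq fun s hs => ?_
    simpa [abs_of_pos hs] using hbound s hs.ne'
  · have hsub : |∫ s in (0:ℝ)..t, f s| = |∫ s in (0:ℝ)..|t|, f (-s)| := by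
      rw [intervalIntegral.integral_comp_neg, abs_of_nonpos ht, neg_neg, neg_zero,
        intervalIntegral.integral_symm, abs_neg]
    rw [hsub]
    refine abs_integral_le_add_of_abs_le (abs_nonneg t) hp hq fun s hs => ?_
    simpa [abs_of_pos hs] using hbound (-s) (neg_ne_zero.mpr hs.ne')
end
end

section
/- Let f : ℝ → ℝ be continuous, set F(t) = ∫_0^t f(s) ds, and let θ > 0 be such that 0 < θ F(t) ≤ t f(t) for all t ≠ 0. Then there exist constants C₅, C₆ > 0 such that F(t) ≥ C₅ |t|^θ − C₆ for all t ∈ ℝ. -/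
open MeasureTheory Filter Topology

noncomputable section

/-- If `G` has derivative `g` and `θ G(t) ≤ t g(t)` on `[1, ∞)`, then `G 1 * t ^ θ ≤ G t` there. -/
theorem mul_rpow_le_of_mul_le_mul_deriv {G g : ℝ → ℝ} {θ : ℝ}
    (hG : ∀ t, 1 ≤ t → HasDerivAt G (g t) t) (h : ∀ t, 1 ≤ t → θ * G t ≤ t * g t)
    {t : ℝ} (ht : 1 ≤ t) : G 1 * t ^ θ ≤ G t := by
  have hderiv (x : ℝ) (hx : 1 ≤ x) : HasDerivAt (fun y => G y * y ^ (-θ))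
      (g x * x ^ (-θ) + G x * (-θ * x ^ (-θ - 1))) x :=
    (hG x hx).mul (Real.hasDerivAt_rpow_const (Or.inl (by positivity)))
  have hmono : MonotoneOn (fun y => G y * y ^ (-θ)) (Set.Ici 1) := by
    refine monotoneOn_of_hasDerivWithinAt_nonneg (convex_Ici 1)
      (fun x hx => (hderiv x hx).continuousAt.continuousWithinAt)
      (fun x hx => (hderiv x (interior_subset hx)).hasDerivWithinAt) fun x hx => ?_
    have hx : 1 ≤ x := interior_subset hx
    have hx0 : 0 < x := by linarith
    have hpow : x ^ (-θ) = x * x ^ (-θ - 1) := by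
      rw [Real.rpow_sub_one hx0.ne']
      field_simp
    rw [hpow]
    nlinarith [mul_nonneg (sub_nonneg.2 (h x hx)) (Real.rpow_nonneg hx0.le (-θ - 1))]
  have ht0 : 0 < t := by linarith
  have hle : G 1 ≤ G t * t ^ (-θ) := by
    simpa using hmono Set.self_mem_Ici (Set.mem_Ici.2 ht) ht
  rwa [Real.rpow_neg ht0.le, ← div_eq_mul_inv, le_div_iff₀ (Real.rpow_pos_of_pos ht0 θ)] at hle

/-- The Ambrosetti–Rabinowitz growth estimate: if `0 < θ F(t) ≤ t f(t)` for all `t ≠ 0`,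
then `F(t) ≥ C₅ |t|^θ - C₆` for suitable constants `C₅, C₆ > 0`. -/
theorem ar_growth (f : ℝ → ℝ) (hf : Continuous f)
    (F : ℝ → ℝ) (hFdef : ∀ t, F t = ∫ s in (0:ℝ)..t, f s)
    (θ : ℝ) (hθ : 0 < θ)
    (hAR : ∀ t : ℝ, t ≠ 0 → 0 < θ * F t ∧ θ * F t ≤ t * f t) :
    ∃ C₅ C₆ : ℝ, 0 < C₅ ∧ 0 < C₆ ∧ ∀ t : ℝ, C₅ * |t| ^ θ - C₆ ≤ F t := by
  have hpos (t : ℝ) (ht : t ≠ 0) : 0 < F t := (mul_pos_iff_of_pos_left hθ).1 (hAR t ht).1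
  have hF (t : ℝ) : HasDerivAt F (f t) t := by
    rw [funext hFdef]
    exact hf.integral_hasStrictDerivAt 0 t |>.hasDerivAt
  have hF0 : F 0 = 0 := by simp [hFdef]
  have hFnonneg (t : ℝ) : 0 ≤ F t := by
    rcases eq_or_ne t 0 with rfl | ht
    · exact hF0.ge
    · exact (hpos t ht).le
  have hright (t : ℝ) (ht : 1 ≤ t) : F 1 * t ^ θ ≤ F t :=
    mul_rpow_le_of_mul_le_mul_deriv (fun s _ => hF s)
      (fun s hs => (hAR s (by positivity)).2) ht
  have hleft (t : ℝ) (ht : 1 ≤ t) : F (-1) * t ^ θ ≤ F (-t) := by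
    refine mul_rpow_le_of_mul_le_mul_deriv (G := fun s => F (-s)) (g := fun s => -f (-s))
      (fun s _ => ?_) (fun s hs => ?_) ht
    · simpa [Function.comp_def] using (hF (-s)).comp s (hasDerivAt_neg s)
    · simpa using (hAR (-s) (neg_ne_zero.2 (by positivity))).2
  have hC : 0 < min (F 1) (F (-1)) := lt_min (hpos 1 (by simp)) (hpos (-1) (by simp))
  refine ⟨min (F 1) (F (-1)), min (F 1) (F (-1)), hC, hC, fun t => ?_⟩
  rcases le_total |t| 1 with ht | ht
  · have hpow : |t| ^ θ ≤ 1 := Real.rpow_le_one (abs_nonneg t) ht hθ.le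
    nlinarith [hFnonneg t]
  · have hpow : 0 ≤ |t| ^ θ := Real.rpow_nonneg (abs_nonneg t) θ
    rcases abs_choice t with h | h
    · have hle := hright |t| ht
      have hmin := mul_le_mul_of_nonneg_right (min_le_left (F 1) (F (-1))) hpow
      nth_rewrite 2 [h] at hle
      linarith
    · have hle := hleft |t| ht
      have hmin := mul_le_mul_of_nonneg_right (min_le_right (F 1) (F (-1))) hpow
      nth_rewrite 2 [h] at hle
      rw [neg_neg] at hle
      linarith
end
end

section
/- Let φ : (0,∞) → (0,∞) be continuous with t ↦ tφ(t) strictly increasing, tφ(t) → 0 as t → 0⁺ and tφ(t) → ∞ as t → ∞, set Φ(t) = ∫_0^{|t|} s φ(s) ds, and assume there are 1 ≤ l ≤ m < ∞ with l ≤ t²φ(t)/Φ(t) ≤ m for all t > 0. Let V : ℝ^N → ℝ be continuous and bounded, let f : ℝ → ℝ be continuous with F(t) = ∫_0^t f(s) ds, and assume there is θ > m with 0 < θ F(t) ≤ t f(t) for all t ≠ 0. Then for every compactly supported smooth function ψ : ℝ^N → ℝ with ψ ≢ 0, the quantity I(tψ) := ∫_{ℝ^N} Φ(t ‖∇ψ‖)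 dx + ∫_{ℝ^N} V(x) Φ(t |ψ|) dx − ∫_{ℝ^N} F(t ψ(x)) dx tends to −∞ as t → +∞. -/
open MeasureTheory Filter Topology

noncomputable section

/-- Grönwall-type bound: `t G'(t) ≤ m G(t)` forces `G(t) ≤ t ^ m G(1)` for `t ≥ 1`. -/
theorem le_rpow_mul_of_mul_deriv_le {G G' : ℝ → ℝ} {m : ℝ}
    (hG : ∀ t, 0 < t → HasDerivAt G (G' t) t)
    (hle : ∀ t, 0 < t → t * G' t ≤ m * G t) {t : ℝ} (ht : 1 ≤ t) :
    G t ≤ t ^ m * G 1 := by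
  have hd : ∀ s, 0 < s → HasDerivAt (fun s => G s * s ^ (-m))
      (G' s * s ^ (-m) + G s * (-m * s ^ (-m - 1))) s := fun s hs =>
    (hG s hs).mul (Real.hasDerivAt_rpow_const (Or.inl hs.ne'))
  have hanti : AntitoneOn (fun s => G s * s ^ (-m)) (Set.Ici 1) := by
    apply antitoneOn_of_hasDerivWithinAt_nonpos (convex_Ici 1)
      (f' := fun s => G' s * s ^ (-m) + G s * (-m * s ^ (-m - 1)))
    · intro s hs
      exact (hd s (one_pos.trans_le hs)).continuousAt.continuousWithinAt
    · intro s hs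
      rw [interior_Ici] at hs
      exact (hd s (one_pos.trans hs)).hasDerivWithinAt
    · intro s hs
      rw [interior_Ici] at hs
      have hs0 : 0 < s := one_pos.trans hs
      have hsplit : s ^ (-m) = s * s ^ (-m - 1) := by
        rw [Real.rpow_sub_one hs0.ne']
        field_simp
      have hp : 0 < s ^ (-m - 1) := Real.rpow_pos_of_pos hs0 _
      rw [hsplit]
      nlinarith [mul_nonneg (sub_nonneg.2 (hle s hs0)) hp.le]
  have h1 : G t * t ^ (-m) ≤ G 1 := by
    simpa using hanti (Set.mem_Ici.2 le_rfl) (Set.mem_Ici.2 ht) ht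
  have ht0 : 0 < t := one_pos.trans_le ht
  rwa [Real.rpow_neg ht0.le, ← div_eq_mul_inv, div_le_iff₀ (Real.rpow_pos_of_pos ht0 _),
    mul_comm] at h1

/-- A function continuous on `(0, ∞)` with limit `0` at `0⁺` extends by zero continuously. -/
theorem continuous_indicator_Ioi_zero {g : ℝ → ℝ} (hg : ContinuousOn g (Set.Ioi 0))
    (h0 : Tendsto g (𝓝[>] (0 : ℝ)) (𝓝 0)) : Continuous ((Set.Ioi (0 : ℝ)).indicator g) := by
  rw [continuous_iff_continuousAt]
  intro s
  rcases lt_trichotomy s 0 with hs | rfl | hs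
  · have : (Set.Ioi (0 : ℝ)).indicator g =ᶠ[𝓝 s] fun _ => 0 := by
      filter_upwards [Iio_mem_nhds hs] with x hx
      exact Set.indicator_of_notMem (not_lt.2 (le_of_lt hx)) g
    exact continuousAt_const.congr this.symm
  · rw [continuousAt_iff_continuous_left'_right']
    have hz : (Set.Ioi (0 : ℝ)).indicator g 0 = 0 := by simp
    constructor
    · refine (tendsto_const_nhds (x := (0 : ℝ))).congr' ?_ |>.trans (by rw [hz])
      filter_upwards [self_mem_nhdsWithin] with x hx
      exact (Set.indicator_of_notMem (not_lt.2 (le_of_lt hx)) g).symm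
    · refine (h0.congr' ?_).trans (by rw [hz])
      filter_upwards [self_mem_nhdsWithin] with x hx
      exact (Set.indicator_of_mem hx g).symm
  · have : (Set.Ioi (0 : ℝ)).indicator g =ᶠ[𝓝 s] g := by
      filter_upwards [Ioi_mem_nhds hs] with x hx
      exact Set.indicator_of_mem hx g
    exact (hg.continuousAt (Ioi_mem_nhds hs)).congr this.symm

/-- If `m < θ` and `0 < B`, then `A t ^ m - B t ^ θ` tends to `-∞`. -/
theorem tendsto_mul_rpow_sub_mul_rpow_atBot {A B m θ : ℝ} (hθ0 : 0 < θ) (hθ : m < θ)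
    (hB : 0 < B) : Tendsto (fun t : ℝ => A * t ^ m - B * t ^ θ) atTop atBot := by
  have h1 : Tendsto (fun t : ℝ => A * t ^ (-(θ - m)) - B) atTop (𝓝 (A * 0 - B)) :=
    ((tendsto_rpow_neg_atTop (sub_pos.2 hθ)).const_mul A).sub_const B
  have h2 := (tendsto_rpow_atTop hθ0).atTop_mul_neg (by linarith : A * 0 - B < 0) h1
  refine h2.congr' ?_
  filter_upwards [eventually_gt_atTop 0] with t ht
  have : t ^ m = t ^ θ * t ^ (-(θ - m)) := by
    rw [← Real.rpow_add ht]
    congr 1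
    ring
  rw [this]
  ring

/-- Mountain pass geometry, part (ii) of Lemma 4.2: for any compactly supported smooth
`ψ ≢ 0`, `I(tψ) = ∫ Φ(t‖∇ψ‖) + ∫ V Φ(t|ψ|) - ∫ F(tψ) → -∞` as `t → +∞`. -/
theorem mountain_pass_geometry_ii (N : ℕ) (φfun : ℝ → ℝ)
    (hφc : ContinuousOn φfun (Set.Ioi 0))
    (hφpos : ∀ t, 0 < t → 0 < φfun t)
    (hφmono : StrictMonoOn (fun t => t * φfun t) (Set.Ioi 0))
    (hφ0 : Tendsto (fun t => t * φfun t) (𝓝[>] (0 : ℝ)) (𝓝 0))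
    (hφinf : Tendsto (fun t => t * φfun t) atTop atTop)
    (Φ : ℝ → ℝ) (hΦdef : ∀ t, Φ t = ∫ s in (0:ℝ)..|t|, s * φfun s)
    (l m : ℝ) (hl : 1 ≤ l) (hlm : l ≤ m)
    (hsand : ∀ t, 0 < t → l ≤ t ^ 2 * φfun t / Φ t ∧ t ^ 2 * φfun t / Φ t ≤ m)
    (V : EuclideanSpace ℝ (Fin N) → ℝ) (hVc : Continuous V)
    (CV : ℝ) (hVbd : ∀ x, |V x| ≤ CV)
    (f : ℝ → ℝ) (hf : Continuous f)
    (F : ℝ → ℝ) (hFdef : ∀ t, F t = ∫ s in (0:ℝ)..t, f s)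
    (θ : ℝ) (hθ : m < θ)
    (hAR : ∀ t : ℝ, t ≠ 0 → 0 < θ * F t ∧ θ * F t ≤ t * f t)
    (ψ : EuclideanSpace ℝ (Fin N) → ℝ)
    (hψs : ContDiff ℝ (⊤ : ℕ∞) ψ) (hψc : HasCompactSupport ψ) (hψ0 : ψ ≠ 0) :
    Tendsto (fun t : ℝ =>
        (∫ x, Φ (t * ‖gradient ψ x‖)) + (∫ x, V x * Φ (t * |ψ x|)) -
          ∫ x, F (t * ψ x))
      atTop atBot := by
  have hθ0 : 0 < θ := by linarith
  have hgc := continuous_indicator_Ioi_zero (g := fun t => t * φfun t)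
    (continuousOn_id.mul hφc) hφ0
  set g : ℝ → ℝ := (Set.Ioi (0 : ℝ)).indicator fun t => t * φfun t with hg
  have hΦg : ∀ t, Φ t = ∫ s in (0:ℝ)..|t|, g s := by
    intro t
    rw [hΦdef]
    refine intervalIntegral.integral_congr fun s hs => ?_
    rw [Set.uIcc_of_le (abs_nonneg t)] at hs
    rcases hs.1.eq_or_lt with rfl | h
    · simp [hg]
    · exact (Set.indicator_of_mem (Set.mem_Ioi.2 h) fun t => t * φfun t).symm
  have hPd : ∀ t, HasDerivAt (fun u => ∫ s in (0:ℝ)..u, g s) (g t) t := fun t =>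
    hgc.integral_hasStrictDerivAt 0 t |>.hasDerivAt
  have hPc : Continuous fun u => ∫ s in (0:ℝ)..u, g s :=
    continuous_iff_continuousAt.2 fun t => (hPd t).continuousAt
  have hΦc : Continuous Φ := by
    rw [funext hΦg]
    exact hPc.comp continuous_abs
  have hΦ0 : Φ 0 = 0 := by simp [hΦdef]
  have hΦd : ∀ t, 0 < t → HasDerivAt Φ (t * φfun t) t := by
    intro t ht
    have h := hPd t
    rw [hg, Set.indicator_of_mem (Set.mem_Ioi.2 ht)] at h
    refine h.congr_of_eventuallyEq ?_
    filter_upwards [Ioi_mem_nhds ht] with u hu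
    rw [hΦg, abs_of_pos hu]
  have hΦpos : ∀ t, 0 < t → 0 < Φ t := by
    intro t ht
    have hn : 0 < t ^ 2 * φfun t := mul_pos (pow_pos ht 2) (hφpos t ht)
    have hq : 0 < t ^ 2 * φfun t / Φ t := by linarith [(hsand t ht).1]
    exact (div_pos_iff_of_pos_left hn).1 hq
  have hΦnn : ∀ t, 0 ≤ t → 0 ≤ Φ t := fun t ht =>
    ht.eq_or_lt.elim (fun h => by rw [← h, hΦ0]) fun h => (hΦpos t h).le
  have hΦgrow : ∀ r, 0 ≤ r → ∀ t, 1 ≤ t → Φ (t * r) ≤ t ^ m * Φ r := by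
    intro r hr t ht
    rcases hr.eq_or_lt with rfl | hr
    · simp [hΦ0]
    have := le_rpow_mul_of_mul_deriv_le (G := fun s => Φ (s * r))
      (G' := fun s => s * r * φfun (s * r) * r) (m := m)
      (fun s hs => (hΦd (s * r) (mul_pos hs hr)).comp s (hasDerivAt_mul_const r))
      (fun s hs => by
        have hsr := mul_pos hs hr
        have := (div_le_iff₀ (hΦpos _ hsr)).1 (hsand _ hsr).2
        linarith) ht
    simpa using this
  have hFd : ∀ t, HasDerivAt F (f t) t := by
    intro t
    rw [funext hFdef]
    exact hf.integral_hasStrictDerivAt 0 t |>.hasDerivAt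
  have hFc : Continuous F := continuous_iff_continuousAt.2 fun t => (hFd t).continuousAt
  have hF0 : F 0 = 0 := by simp [hFdef]
  have hFpos : ∀ t, t ≠ 0 → 0 < F t := fun t ht => pos_of_mul_pos_right (hAR t ht).1 hθ0.le
  have hFgrow : ∀ u t, 1 ≤ t → t ^ θ * F u ≤ F (t * u) := by
    intro u t ht
    rcases eq_or_ne u 0 with rfl | hu
    · simp [hF0]
    have := le_rpow_mul_of_mul_deriv_le (G := fun s => -F (s * u))
      (G' := fun s => -(f (s * u) * u)) (m := θ)
      (fun s hs => ((hFd (s * u)).comp s (hasDerivAt_mul_const u)).neg)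
      (fun s hs => by linarith [(hAR _ (mul_ne_zero hs.ne' hu)).2]) ht
    simp only [one_mul] at this
    linarith
  have hgradc : Continuous (gradient ψ) :=
    (InnerProductSpace.toDual ℝ _).symm.continuous.comp (hψs.continuous_fderiv (by simp))
  have hgrads : HasCompactSupport (gradient ψ) :=
    (hψc.fderiv ℝ).comp_left (g := (InnerProductSpace.toDual ℝ _).symm) (map_zero _)
  have hi1 : Integrable fun x => Φ ‖gradient ψ x‖ :=
    (hΦc.comp hgradc.norm).integrable_of_hasCompactSupport
      (hgrads.comp_left (g := fun v => Φ ‖v‖) (by simp [hΦ0]))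
  have hi2 : Integrable fun x => Φ |ψ x| :=
    (hΦc.comp hψs.continuous.abs).integrable_of_hasCompactSupport
      (hψc.comp_left (g := fun v => Φ |v|) (by simp [hΦ0]))
  have hFs : ∀ t : ℝ, HasCompactSupport fun x => F (t * ψ x) := fun t =>
    hψc.comp_left (g := fun v => F (t * v)) (by simp [hF0])
  have hi3 : ∀ t : ℝ, Integrable fun x => F (t * ψ x) := fun t =>
    (hFc.comp (continuous_const.mul hψs.continuous)).integrable_of_hasCompactSupport (hFs t)
  have hi4 : Integrable fun x => F (ψ x) := by simpa using hi3 1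
  have hB : 0 < ∫ x, F (ψ x) := by
    obtain ⟨x, hx⟩ := Function.ne_iff.1 hψ0
    refine (hFc.comp hψs.continuous).integral_pos_of_hasCompactSupport_nonneg_nonzero
      (by simpa using hFs 1) (fun y => ?_) (x := x) (hFpos _ hx).ne'
    rcases eq_or_ne (ψ y) 0 with h | h
    · simp [h, hF0]
    · exact (hFpos _ h).le
  refine tendsto_atBot_mono' atTop ?_ (tendsto_mul_rpow_sub_mul_rpow_atBot
    (A := (∫ x, Φ ‖gradient ψ x‖) + CV * ∫ x, Φ |ψ x|) hθ0 hθ hB)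
  filter_upwards [eventually_ge_atTop 1] with t ht
  have ht0 : 0 ≤ t := zero_le_one.trans ht
  have e1 : ∫ x, Φ (t * ‖gradient ψ x‖) ≤ t ^ m * ∫ x, Φ ‖gradient ψ x‖ := by
    rw [← integral_const_mul]
    exact integral_mono_of_nonneg
      (Eventually.of_forall fun x => hΦnn _ (mul_nonneg ht0 (norm_nonneg _)))
      (hi1.const_mul _) (Eventually.of_forall fun x => hΦgrow _ (norm_nonneg _) t ht)
  have e2 : ∫ x, V x * Φ (t * |ψ x|) ≤ CV * t ^ m * ∫ x, Φ |ψ x| := by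
    rw [← integral_const_mul]
    refine (Real.le_norm_self _).trans (norm_integral_le_of_norm_le (hi2.const_mul _)
      (Eventually.of_forall fun x => ?_))
    have hn := hΦnn _ (mul_nonneg ht0 (abs_nonneg (ψ x)))
    rw [norm_mul, Real.norm_eq_abs, Real.norm_of_nonneg hn, mul_assoc]
    exact mul_le_mul (hVbd x) (hΦgrow _ (abs_nonneg _) t ht) hn ((abs_nonneg _).trans (hVbd x))
  have e3 : t ^ θ * ∫ x, F (ψ x) ≤ ∫ x, F (t * ψ x) := by
    rw [← integral_const_mul]
    exact integral_mono (hi4.const_mul _) (hi3 t) fun x => hFgrow _ t ht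
  linarith
end
end

section
/- Let φ : (0,∞) → (0,∞) be continuous with t ↦ tφ(t) strictly increasing, tφ(t) → 0 as t → 0⁺ and tφ(t) → ∞ as t → ∞, set Φ(t) = ∫_0^{|t|} s φ(s) ds, and assume there are 1 ≤ l ≤ m < ∞ with l ≤ t²φ(t)/Φ(t) ≤ m for all t > 0. Let V : ℝ^N → ℝ be continuous with V(x) ≥ V₀ > 0 for all x, let f : ℝ → ℝ be continuous with F(t) = ∫_0^t f(s) ds, and let θ > m satisfy 0 < θ F(t) ≤ t f(t) for all t ≠ 0. Let u : ℝ^N → ℝ be a differentiable function for which the integrals ∫ Φ(‖∇u‖), ∫ Φ(|u|), ∫ φ(‖∇u‖)‖∇u‖², ∫ V φ(|u|)u², ∫ F(u) and ∫ f(u)u over ℝ^N are all finite (with integrands vanishing where ∇u = 0, resp. u = 0). Then, with I(u) = ∫ Φ(‖∇u‖) dx + ∫ V(x)Φ(|u|) dx − ∫ F(u) dx and D(u) = ∫ φ(‖∇u‖)‖∇u‖² dx + ∫ V(x)φ(|u|)u² dx − ∫ f(u)u dx, one has I(u) − (1/θ) D(u) ≥ min{1, V₀} · ((θ − m)/θ)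 · ∫_{ℝ^N} ( Φ(‖∇u‖) + Φ(|u|) ) dx. -/
open MeasureTheory Filter Topology
open scoped Classical

noncomputable section

/-- The growth condition makes `Φ` positive and comparable to `t ^ 2 * φ t`. -/
theorem le_and_le_mul_of_growth {φ Φ : ℝ → ℝ} {l m t : ℝ} (hl : 1 ≤ l) (hφ : 0 < φ t) (ht : 0 < t)
    (h : l ≤ t ^ 2 * φ t / Φ t ∧ t ^ 2 * φ t / Φ t ≤ m) :
    0 < Φ t ∧ Φ t ≤ φ t * t ^ 2 ∧ φ t * t ^ 2 ≤ m * Φ t := by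
  have hpos : 0 < t ^ 2 * φ t := by positivity
  have hΦ : 0 < Φ t := by
    by_contra! hneg
    have := div_nonpos_of_nonneg_of_nonpos hpos.le hneg
    linarith [h.1]
  have h1 := (le_div_iff₀ hΦ).1 h.1
  have h2 := (div_le_iff₀ hΦ).1 h.2
  exact ⟨hΦ, by nlinarith, by linarith⟩

/-- The coercivity estimate from Lemma 4.3 (boundedness of Palais–Smale sequences):
`I(u) - (1/θ) D(u) ≥ min{1, V₀} ((θ - m)/θ) ∫ (Φ(‖∇u‖) + Φ(|u|))`, where
`I(u) = ∫ Φ(‖∇u‖) + ∫ V Φ(|u|) - ∫ F(u)` and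
`D(u) = ∫ φ(‖∇u‖)‖∇u‖² + ∫ V φ(|u|)u² - ∫ f(u)u`. -/
theorem coercivity_estimate (N : ℕ) (φfun : ℝ → ℝ)
    (hφc : ContinuousOn φfun (Set.Ioi 0))
    (hφpos : ∀ t, 0 < t → 0 < φfun t)
    (hφmono : StrictMonoOn (fun t => t * φfun t) (Set.Ioi 0))
    (hφ0 : Tendsto (fun t => t * φfun t) (𝓝[>] (0 : ℝ)) (𝓝 0))
    (hφinf : Tendsto (fun t => t * φfun t) atTop atTop)
    (Φ : ℝ → ℝ) (hΦdef : ∀ t, Φ t = ∫ s in (0:ℝ)..|t|, s * φfun s)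
    (l m : ℝ) (hl : 1 ≤ l) (hlm : l ≤ m)
    (hsand : ∀ t, 0 < t → l ≤ t ^ 2 * φfun t / Φ t ∧ t ^ 2 * φfun t / Φ t ≤ m)
    (V : EuclideanSpace ℝ (Fin N) → ℝ) (hVc : Continuous V)
    (V₀ : ℝ) (hV₀ : 0 < V₀) (hVlb : ∀ x, V₀ ≤ V x)
    (f : ℝ → ℝ) (hf : Continuous f)
    (F : ℝ → ℝ) (hFdef : ∀ t, F t = ∫ s in (0:ℝ)..t, f s)
    (θ : ℝ) (hθ : m < θ)
    (hAR : ∀ t : ℝ, t ≠ 0 → 0 < θ * F t ∧ θ * F t ≤ t * f t)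
    (u : EuclideanSpace ℝ (Fin N) → ℝ) (hu : Differentiable ℝ u)
    (h1 : Integrable (fun x => Φ ‖gradient u x‖))
    (h2 : Integrable (fun x => Φ |u x|))
    (h3 : Integrable (fun x =>
      if gradient u x = 0 then (0:ℝ) else φfun ‖gradient u x‖ * ‖gradient u x‖ ^ 2))
    (h4 : Integrable (fun x =>
      V x * if u x = 0 then (0:ℝ) else φfun |u x| * u x ^ 2))
    (h5 : Integrable (fun x => F (u x)))
    (h6 : Integrable (fun x => f (u x) * u x)) :
    min 1 V₀ * ((θ - m) / θ) * ((∫ x, Φ ‖gradient u x‖) + ∫ x, Φ |u x|) ≤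
      (((∫ x, Φ ‖gradient u x‖) + (∫ x, V x * Φ |u x|) - ∫ x, F (u x)) -
        (1 / θ) *
          ((∫ x, if gradient u x = 0 then (0:ℝ)
              else φfun ‖gradient u x‖ * ‖gradient u x‖ ^ 2) +
            (∫ x, V x * if u x = 0 then (0:ℝ) else φfun |u x| * u x ^ 2) -
            ∫ x, f (u x) * u x)) := by
  have hθ0 : 0 < θ := by linarith
  have hΦ0 : Φ 0 = 0 := by simp [hΦdef]
  have hF0 : F 0 = 0 := by simp [hFdef]
  have growth : ∀ t, 0 < t → 0 < Φ t ∧ Φ t ≤ φfun t * t ^ 2 ∧ φfun t * t ^ 2 ≤ m * Φ t :=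
    fun t ht => le_and_le_mul_of_growth hl (hφpos t ht) ht (hsand t ht)
  have hΦnn : ∀ t, 0 ≤ t → 0 ≤ Φ t := fun t ht => by
    rcases ht.eq_or_lt with rfl | ht
    · exact hΦ0.ge
    · exact (growth t ht).1.le
  have hgrad : ∀ x, (if gradient u x = 0 then (0 : ℝ)
      else φfun ‖gradient u x‖ * ‖gradient u x‖ ^ 2) ≤ m * Φ ‖gradient u x‖ := fun x => by
    split_ifs with h
    · simp [h, hΦ0]
    · exact (growth _ (norm_pos_iff.2 h)).2.2
  have hval : ∀ x, Φ |u x| ≤ (if u x = 0 then (0 : ℝ) else φfun |u x| * u x ^ 2) ∧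
      (if u x = 0 then (0 : ℝ) else φfun |u x| * u x ^ 2) ≤ m * Φ |u x| := fun x => by
    split_ifs with h
    · simp [h, hΦ0]
    · have := (growth _ (abs_pos.2 h)).2
      rwa [sq_abs] at this
  have hVpos : ∀ x, 0 ≤ V x := fun x => hV₀.le.trans (hVlb x)
  have hVΦ : Integrable (fun x => V x * Φ |u x|) := by
    refine h4.mono' (hVc.aestronglyMeasurable.mul h2.aestronglyMeasurable) (ae_of_all _ fun x => ?_)
    rw [Real.norm_of_nonneg (mul_nonneg (hVpos x) (hΦnn _ (abs_nonneg _)))]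
    exact mul_le_mul_of_nonneg_left (hval x).1 (hVpos x)
  have hA : 0 ≤ ∫ x, Φ ‖gradient u x‖ := integral_nonneg fun x => hΦnn _ (norm_nonneg _)
  have hB : 0 ≤ ∫ x, Φ |u x| := integral_nonneg fun x => hΦnn _ (abs_nonneg _)
  have hG := integral_mono h3 (h1.const_mul m) hgrad
  have hVG := integral_mono h4 (hVΦ.const_mul m) fun x =>
    (mul_le_mul_of_nonneg_left (hval x).2 (hVpos x)).trans_eq (mul_left_comm _ _ _)
  have hVB := integral_mono (h2.const_mul V₀) hVΦ fun x =>
    mul_le_mul_of_nonneg_right (hVlb x) (hΦnn _ (abs_nonneg _))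
  have hFf := integral_mono (h5.const_mul θ) h6 fun x => by
    by_cases h : u x = 0
    · simp [h, hF0]
    · exact (hAR _ h).2.trans_eq (mul_comm _ _)
  simp only [integral_const_mul] at hG hVG hVB hFf
  generalize (∫ x, Φ ‖gradient u x‖) = A at *
  generalize (∫ x, Φ |u x|) = B at *
  generalize (∫ x, V x * Φ |u x|) = C at *
  generalize (∫ x, if gradient u x = 0 then (0 : ℝ)
    else φfun ‖gradient u x‖ * ‖gradient u x‖ ^ 2) = G at *
  generalize (∫ x, V x * if u x = 0 then (0 : ℝ) else φfun |u x| * u x ^ 2) = W at *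
  have hmin : min 1 V₀ * (A + B) ≤ A + C := by
    have hmin1 := mul_le_mul_of_nonneg_right (min_le_left 1 V₀) hA
    have hmin2 := mul_le_mul_of_nonneg_right (min_le_right 1 V₀) hB
    linarith
  have hscaled := mul_le_mul_of_nonneg_left hmin (sub_pos.2 hθ).le
  field_simp
  linarith
end
end
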